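/- arXiv:2602.04715 — 6 statements merged into one kernel-verified Lean document; each statement's English description precedes it below -/
import Mathlib

section
/- The integer symplectic group Sp(2g,ℤ) is generated by the set consisting of the matrix J_{2g}, the matrices D_A for all A ∈ GL(g,ℤ), and the matrices T_B for all symmetric integer g×g matrices B; i.e., the subgroup of Sp(2g,ℤ) generated by these elements is all of Sp(2g,ℤ). -/
open Matrix

/-- The standard symplectic form matrix `J_{2g} = [[0, I_g], [−I_g, 0]]`. -/
def Jmat (g : ℕ) : Matrix (Fin g ⊕ Fin g) (Fin g ⊕ Fin g) ℤ :=
  Matrix.fromBlocks 0 1 (-1) 0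

/-- `M` belongs to the integer symplectic group `Sp(2g,ℤ)`: `Mᵀ J M = J`. -/
def IsSymplectic {g : ℕ} (M : Matrix (Fin g ⊕ Fin g) (Fin g ⊕ Fin g) ℤ) : Prop :=
  Mᵀ * Jmat g * M = Jmat g

/-- The block matrix `D_A = [[A, 0], [0, (Aᵀ)⁻¹]]`. -/
noncomputable def Dmat {g : ℕ} (A : Matrix (Fin g) (Fin g) ℤ) :
    Matrix (Fin g ⊕ Fin g) (Fin g ⊕ Fin g) ℤ :=
  Matrix.fromBlocks A 0 0 (Aᵀ)⁻¹

/-- The block matrix `T_B = [[I_g, B], [0, I_g]]`. -/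
def Tmat {g : ℕ} (B : Matrix (Fin g) (Fin g) ℤ) :
    Matrix (Fin g ⊕ Fin g) (Fin g ⊕ Fin g) ℤ :=
  Matrix.fromBlocks 1 B 0 1

/-- The integer symplectic group `Sp(2g,ℤ)`, realized as a subgroup of the group of
invertible `2g × 2g` integer matrices. -/
def Sp (g : ℕ) : Subgroup (Matrix (Fin g ⊕ Fin g) (Fin g ⊕ Fin g) ℤ)ˣ where
  carrier := {M | IsSymplectic (M : Matrix (Fin g ⊕ Fin g) (Fin g ⊕ Fin g) ℤ)}
  one_mem' := by
    simp [IsSymplectic, Set.mem_setOf_eq]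
  mul_mem' := by
    intro a b ha hb
    simp only [Set.mem_setOf_eq, IsSymplectic, Units.val_mul, Matrix.transpose_mul] at *
    have h : (b : Matrix (Fin g ⊕ Fin g) (Fin g ⊕ Fin g) ℤ)ᵀ * (a : Matrix _ _ ℤ)ᵀ * Jmat g *
        ((a : Matrix _ _ ℤ) * (b : Matrix _ _ ℤ)) =
        (b : Matrix _ _ ℤ)ᵀ * ((a : Matrix _ _ ℤ)ᵀ * Jmat g * (a : Matrix _ _ ℤ)) *
          (b : Matrix _ _ ℤ) := by
      noncomm_ring
    rw [h, ha]
    exact hb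
  inv_mem' := by
    intro a ha
    simp only [Set.mem_setOf_eq, IsSymplectic] at ha ⊢
    have h1 : (a : Matrix (Fin g ⊕ Fin g) (Fin g ⊕ Fin g) ℤ) *
        ((a⁻¹ : (Matrix (Fin g ⊕ Fin g) (Fin g ⊕ Fin g) ℤ)ˣ) : Matrix _ _ ℤ) = 1 :=
      a.mul_inv
    calc ((a⁻¹ : (Matrix (Fin g ⊕ Fin g) (Fin g ⊕ Fin g) ℤ)ˣ) : Matrix _ _ ℤ)ᵀ * Jmat g *
          ((a⁻¹ : (Matrix (Fin g ⊕ Fin g) (Fin g ⊕ Fin g) ℤ)ˣ) : Matrix _ _ ℤ)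
        = ((a⁻¹ : (Matrix (Fin g ⊕ Fin g) (Fin g ⊕ Fin g) ℤ)ˣ) : Matrix _ _ ℤ)ᵀ *
            ((a : Matrix _ _ ℤ)ᵀ * Jmat g * (a : Matrix _ _ ℤ)) *
            ((a⁻¹ : (Matrix (Fin g ⊕ Fin g) (Fin g ⊕ Fin g) ℤ)ˣ) : Matrix _ _ ℤ) := by
          rw [ha]
      _ = ((a : Matrix _ _ ℤ) * ((a⁻¹ : (Matrix (Fin g ⊕ Fin g) (Fin g ⊕ Fin g) ℤ)ˣ) :
            Matrix _ _ ℤ))ᵀ * Jmat g *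
            ((a : Matrix _ _ ℤ) * ((a⁻¹ : (Matrix (Fin g ⊕ Fin g) (Fin g ⊕ Fin g) ℤ)ˣ) :
              Matrix _ _ ℤ)) := by
          rw [Matrix.transpose_mul]; noncomm_ring
      _ = Jmat g := by rw [h1]; simp

section Helpers

/-- The generated subgroup. -/
def KK (g : ℕ) : Subgroup (Sp g) :=
    Subgroup.closure {x : Sp g |
      ((x : (Matrix (Fin g ⊕ Fin g) (Fin g ⊕ Fin g) ℤ)ˣ) : Matrix _ _ ℤ) = Jmat g ∨
      (∃ A : Matrix (Fin g) (Fin g) ℤ, IsUnit A ∧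
        ((x : (Matrix (Fin g ⊕ Fin g) (Fin g ⊕ Fin g) ℤ)ˣ) : Matrix _ _ ℤ) = Dmat A) ∨
      (∃ B : Matrix (Fin g) (Fin g) ℤ, Bᵀ = B ∧
        ((x : (Matrix (Fin g ⊕ Fin g) (Fin g ⊕ Fin g) ℤ)ˣ) : Matrix _ _ ℤ) = Tmat B)}

/-- The matrix is the underlying matrix of an element of the generated subgroup. -/
def InK {g : ℕ} (M : Matrix (Fin g ⊕ Fin g) (Fin g ⊕ Fin g) ℤ) : Prop :=
  ∃ x : Sp g, x ∈ KK g ∧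
    ((x : (Matrix (Fin g ⊕ Fin g) (Fin g ⊕ Fin g) ℤ)ˣ) : Matrix _ _ ℤ) = M

variable {g : ℕ}

theorem InK.one : InK (1 : Matrix (Fin g ⊕ Fin g) (Fin g ⊕ Fin g) ℤ) :=
  ⟨1, one_mem _, by simp⟩

theorem InK.mul {M N : Matrix (Fin g ⊕ Fin g) (Fin g ⊕ Fin g) ℤ} (hM : InK M) (hN : InK N) :
    InK (M * N) := by
  obtain ⟨x, hx, rfl⟩ := hM
  obtain ⟨y, hy, rfl⟩ := hN
  exact ⟨x * y, mul_mem hx hy, by simp⟩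

theorem InK.symp {M : Matrix (Fin g ⊕ Fin g) (Fin g ⊕ Fin g) ℤ} (hM : InK M) :
    IsSymplectic M := by
  obtain ⟨x, hx, rfl⟩ := hM
  exact x.2

theorem symp_mul {M N : Matrix (Fin g ⊕ Fin g) (Fin g ⊕ Fin g) ℤ} (hM : IsSymplectic M)
    (hN : IsSymplectic N) : IsSymplectic (M * N) := by
  unfold IsSymplectic at *
  have h : (M * N)ᵀ * Jmat g * (M * N) = Nᵀ * (Mᵀ * Jmat g * M) * N := by
    rw [transpose_mul]; noncomm_ring
  rw [h, hM, hN]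

theorem symp_J : IsSymplectic (Jmat g) := by
  simp [IsSymplectic, Jmat, fromBlocks_transpose, fromBlocks_multiply]

theorem inK_J : InK (Jmat g) := by
  have h1 : Jmat g * -Jmat g = 1 := by
    simp [Jmat, fromBlocks_multiply, fromBlocks_neg]
  have h2 : -Jmat g * Jmat g = 1 := by
    simp [Jmat, fromBlocks_multiply, fromBlocks_neg]
  exact ⟨⟨⟨Jmat g, -Jmat g, h1, h2⟩, symp_J⟩, Subgroup.subset_closure (Or.inl rfl), rfl⟩

theorem inK_T {B : Matrix (Fin g) (Fin g) ℤ} (hB : Bᵀ = B) : InK (fromBlocks 1 B 0 1) := by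
  have h1 : Tmat B * Tmat (-B) = 1 := by
    simp [Tmat, fromBlocks_multiply]
  have h2 : Tmat (-B) * Tmat B = 1 := by
    simp [Tmat, fromBlocks_multiply]
  refine ⟨⟨⟨Tmat B, Tmat (-B), h1, h2⟩, ?_⟩,
    Subgroup.subset_closure (Or.inr (Or.inr ⟨B, hB, rfl⟩)), rfl⟩
  change IsSymplectic (Tmat B)
  simp [IsSymplectic, Tmat, Jmat, fromBlocks_transpose, fromBlocks_multiply, hB]

theorem inK_L {B : Matrix (Fin g) (Fin g) ℤ} (hB : Bᵀ = B) : InK (fromBlocks 1 0 B 1) := by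
  have h := ((((inK_J (g := g)).mul (inK_T (B := -B) (by simp [hB]))).mul inK_J).mul inK_J).mul inK_J
  convert h using 1
  simp [Jmat, fromBlocks_multiply]

theorem inK_D {A E : Matrix (Fin g) (Fin g) ℤ} (h : Aᵀ * E = 1) : InK (fromBlocks A 0 0 E) := by
  have h' : E * Aᵀ = 1 := mul_eq_one_comm.mp h
  have hinv : (Aᵀ)⁻¹ = E := Matrix.inv_eq_right_inv h
  have k1 : A * Eᵀ = 1 := by
    have := congrArg transpose h'
    simpa using this
  have k2 : Eᵀ * A = 1 := mul_eq_one_comm.mp k1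
  have h1 : fromBlocks A 0 0 E * fromBlocks Eᵀ 0 0 Aᵀ = 1 := by
    simp [fromBlocks_multiply, k1, h']
  have h2 : fromBlocks Eᵀ 0 0 Aᵀ * fromBlocks A 0 0 E = 1 := by
    simp [fromBlocks_multiply, k2, h]
  refine ⟨⟨⟨fromBlocks A 0 0 E, fromBlocks Eᵀ 0 0 Aᵀ, h1, h2⟩, ?_⟩,
    Subgroup.subset_closure (Or.inr (Or.inl ⟨A, ⟨⟨A, Eᵀ, k1, k2⟩, rfl⟩, ?_⟩)), rfl⟩
  · change IsSymplectic (fromBlocks A 0 0 E)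
    simp [IsSymplectic, Jmat, fromBlocks_transpose, fromBlocks_multiply, h, k2]
  · simp [Dmat, hinv]

theorem inK_of_mul {M N : Matrix (Fin g ⊕ Fin g) (Fin g ⊕ Fin g) ℤ} (hN : InK N)
    (h : InK (N * M)) : InK M := by
  obtain ⟨x, hx, rfl⟩ := hN
  obtain ⟨y, hy, hxy⟩ := h
  refine ⟨x⁻¹ * y, mul_mem (inv_mem hx) hy, ?_⟩
  simp [hxy]

/-- Elementary symplectic row operations. -/
theorem op (p q : Fin g ⊕ Fin g) (hpq : p ≠ q) (k : ℤ) :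
    ∃ N : Matrix (Fin g ⊕ Fin g) (Fin g ⊕ Fin g) ℤ, InK N ∧ ∃ e : ℤ,
      ∀ (X : Matrix (Fin g ⊕ Fin g) (Fin g ⊕ Fin g) ℤ) (r c), (N * X) r c = X r c +
        (if r = p then k * X q c else 0) +
        (if r = q.swap ∧ q ≠ p.swap then e * X p.swap c else 0) := by
  have key : ∀ (a b : Fin g) (k : ℤ), a ≠ b →
      InK (fromBlocks (1 + single a b k) 0 0 (1 + single b a (-k))) := by
    intro a b k hab
    apply inK_D
    simp [transpose_add, add_mul, mul_add, single_mul_single_of_ne, hab, hab.symm]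
    rw [add_assoc, ← single_add]; simp
  rcases p with a | a <;> rcases q with b | b
  · have hab : a ≠ b := fun h => hpq (by rw [h])
    refine ⟨_, key a b k hab, -k, ?_⟩
    intro X r c
    rcases r with r | r <;>
      simp [Matrix.mul_apply, Fintype.sum_sum_type, fromBlocks, Matrix.one_apply, add_mul,
        Finset.sum_add_distrib, single_apply, ite_and] <;> grind
  · by_cases hab : a = b
    · subst hab
      refine ⟨_, inK_T (B := single a a k) (by simp), 0, ?_⟩
      intro X r c
      rcases r with r | r <;>
        simp [Matrix.mul_apply, Fintype.sum_sum_type, fromBlocks, Matrix.one_apply, add_mul,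
          Finset.sum_add_distrib, single_apply, ite_and] <;> grind
    · refine ⟨_, inK_T (B := single a b k + single b a k) (by simp [add_comm]), k, ?_⟩
      intro X r c
      rcases r with r | r <;>
        simp [Matrix.mul_apply, Fintype.sum_sum_type, fromBlocks, Matrix.one_apply, add_mul,
          Finset.sum_add_distrib, single_apply, ite_and] <;> grind
  · by_cases hab : a = b
    · subst hab
      refine ⟨_, inK_L (B := single a a k) (by simp), 0, ?_⟩
      intro X r c
      rcases r with r | r <;>
        simp [Matrix.mul_apply, Fintype.sum_sum_type, fromBlocks, Matrix.one_apply, add_mul,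
          Finset.sum_add_distrib, single_apply, ite_and] <;> grind
    · refine ⟨_, inK_L (B := single a b k + single b a k) (by simp [add_comm]), k, ?_⟩
      intro X r c
      rcases r with r | r <;>
        simp [Matrix.mul_apply, Fintype.sum_sum_type, fromBlocks, Matrix.one_apply, add_mul,
          Finset.sum_add_distrib, single_apply, ite_and] <;> grind
  · have hab : b ≠ a := fun h => hpq (by rw [h])
    refine ⟨_, key b a (-k) hab, -k, ?_⟩
    intro X r c
    rcases r with r | r <;>
      simp [Matrix.mul_apply, Fintype.sum_sum_type, fromBlocks, Matrix.one_apply, add_mul,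
        Finset.sum_add_distrib, single_apply, ite_and] <;> grind

/-- The symplectic matrix `X` fixes the basis vectors `e_i` for `i ∈ S`. -/
def St (S : Finset (Fin g)) (X : Matrix (Fin g ⊕ Fin g) (Fin g ⊕ Fin g) ℤ) : Prop :=
  IsSymplectic X ∧ ∀ i ∈ S, ∀ r, X r (Sum.inl i) = if r = Sum.inl i then 1 else 0

theorem symp_entry {X : Matrix (Fin g ⊕ Fin g) (Fin g ⊕ Fin g) ℤ} (h : IsSymplectic X)
    (x y : Fin g ⊕ Fin g) :
    ∑ a, (X (Sum.inl a) x * X (Sum.inr a) y - X (Sum.inr a) x * X (Sum.inl a) y) = Jmat g x y := by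
  have := congrFun (congrFun h x) y
  rw [← this]
  simp [Matrix.mul_apply, Fintype.sum_sum_type, Jmat, fromBlocks, Matrix.one_apply,
    Finset.sum_sub_distrib]
  ring

theorem St.row {S : Finset (Fin g)} {X : Matrix (Fin g ⊕ Fin g) (Fin g ⊕ Fin g) ℤ} (h : St S X)
    {i : Fin g} (hi : i ∈ S) (y : Fin g ⊕ Fin g) :
    X (Sum.inr i) y = Jmat g (Sum.inl i) y := by
  have h1 := symp_entry h.1 (Sum.inl i) y
  rw [← h1]
  simp [h.2 i hi]

theorem St.prim {S : Finset (Fin g)} {X : Matrix (Fin g ⊕ Fin g) (Fin g ⊕ Fin g) ℤ} (h : St S X)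
    {j : Fin g} (hj : j ∉ S) (d : ℤ)
    (hd : ∀ i ∉ S, d ∣ X (Sum.inl i) (Sum.inl j) ∧ d ∣ X (Sum.inr i) (Sum.inl j)) : d ∣ 1 := by
  have h1 := symp_entry h.1 (Sum.inl j) (Sum.inr j)
  have h2 : Jmat g (Sum.inl j) (Sum.inr j) = 1 := by simp [Jmat]
  rw [h2] at h1
  rw [← h1]
  apply Finset.dvd_sum
  intro a _
  by_cases ha : a ∈ S
  · have hne : a ≠ j := fun e => hj (e ▸ ha)
    rw [h.row ha, h.row ha]
    simp [Jmat, hne]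
  · exact dvd_sub (Dvd.dvd.mul_right (hd a ha).1 _) (Dvd.dvd.mul_right (hd a ha).2 _)

/-- The underlying index. -/
def idx (p : Fin g ⊕ Fin g) : Fin g := Sum.elim id id p

@[simp] theorem idx_swap (p : Fin g ⊕ Fin g) : idx p.swap = idx p := by
  cases p <;> rfl

theorem ne_swap (p : Fin g ⊕ Fin g) : p ≠ p.swap := by
  cases p <;> simp

/-- Operation preserving `St S`. -/
theorem St.op {S : Finset (Fin g)} {X : Matrix (Fin g ⊕ Fin g) (Fin g ⊕ Fin g) ℤ} (h : St S X)
    (p q : Fin g ⊕ Fin g) (hpq : p ≠ q) (k : ℤ) (hq : idx q ∉ S)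
    (hp : ∀ i ∈ S, p ≠ Sum.inr i) :
    ∃ N : Matrix (Fin g ⊕ Fin g) (Fin g ⊕ Fin g) ℤ, InK N ∧ St S (N * X) ∧ ∃ e : ℤ,
      ∀ (r c), (N * X) r c = X r c +
        (if r = p then k * X q c else 0) +
        (if r = q.swap ∧ q ≠ p.swap then e * X p.swap c else 0) := by
  obtain ⟨N, hN, e, he⟩ := _root_.op p q hpq k
  refine ⟨N, hN, ⟨symp_mul hN.symp h.1, ?_⟩, e, fun r c => he X r c⟩
  intro i hi r
  rw [he, h.2 i hi, h.2 i hi, h.2 i hi]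
  have h1 : q ≠ Sum.inl i := by rintro rfl; exact hq hi
  have h2 : p.swap ≠ Sum.inl i := by
    intro e
    apply hp i hi
    rw [← Sum.swap_swap p, e]; rfl
  simp [h1, h2]

theorem abs_red (x y : ℤ) (hy : y ≠ 0) (hx : |y| ≤ |x|) : ∃ k : ℤ, (x + k * y).natAbs < x.natAbs := by
  rcases lt_trichotomy x 0 with h1 | h1 | h1 <;> rcases lt_or_gt_of_ne hy with h2 | h2
  · exact ⟨-1, by rw [abs_of_neg h1, abs_of_neg h2] at hx; omega⟩
  · exact ⟨1, by rw [abs_of_neg h1, abs_of_pos h2] at hx; omega⟩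
  · subst h1; simp at hx; omega
  · subst h1; simp at hx; omega
  · exact ⟨1, by rw [abs_of_pos h1, abs_of_neg h2] at hx; omega⟩
  · exact ⟨-1, by rw [abs_of_pos h1, abs_of_pos h2] at hx; omega⟩

/-- Size of a column. -/
def meas (X : Matrix (Fin g ⊕ Fin g) (Fin g ⊕ Fin g) ℤ) (j : Fin g) : ℕ :=
  ∑ r, (X r (Sum.inl j)).natAbs

/-- A reducible column can be made smaller. -/
theorem St.reduce {S : Finset (Fin g)} {X : Matrix (Fin g ⊕ Fin g) (Fin g ⊕ Fin g) ℤ} (h : St S X)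
    {j : Fin g} (hj : j ∉ S) (p q : Fin g ⊕ Fin g) (hpq : p ≠ q) (hq : idx q ∉ S)
    (hq0 : X q (Sum.inl j) ≠ 0) (hle : |X q (Sum.inl j)| ≤ |X p (Sum.inl j)|)
    (hs : q = p.swap ∨ X p.swap (Sum.inl j) = 0) :
    ∃ N : Matrix (Fin g ⊕ Fin g) (Fin g ⊕ Fin g) ℤ, InK N ∧ St S (N * X) ∧
      meas (N * X) j < meas X j := by
  obtain ⟨k, hk⟩ := abs_red _ _ hq0 hle
  have hp : ∀ i ∈ S, p ≠ Sum.inr i := by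
    rintro i hi rfl
    have h0 := h.row hi (Sum.inl j)
    simp only [Jmat, fromBlocks_apply₁₁, Matrix.zero_apply] at h0
    rw [h0] at hle
    simp at hle
    exact hq0 hle
  obtain ⟨N, hN, hSt, e, he⟩ := h.op p q hpq k hq hp
  refine ⟨N, hN, hSt, ?_⟩
  have he' : ∀ r, (N * X) r (Sum.inl j) = X r (Sum.inl j) +
      (if r = p then k * X q (Sum.inl j) else 0) := by
    intro r
    rw [he]
    rcases hs with hs | hs <;> simp [hs]
  unfold meas
  apply Finset.sum_lt_sum
  · intro r _
    rw [he']
    by_cases hr : r = p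
    · subst hr; simpa using hk.le
    · simp [hr]
  · exact ⟨p, Finset.mem_univ _, by rw [he']; simpa using hk⟩

/-- The case where the column is a unit at a single position other than the desired one. -/
theorem St.finish1 {S : Finset (Fin g)} {X : Matrix (Fin g ⊕ Fin g) (Fin g ⊕ Fin g) ℤ} (h : St S X)
    {j : Fin g} (hj : j ∉ S) (p : Fin g ⊕ Fin g) (hpj : p ≠ Sum.inl j) (hp : idx p ∉ S) (u : ℤ)
    (hu : u * u = 1) (hX : ∀ r, X r (Sum.inl j) = if r = p then u else 0) :
    ∃ N : Matrix (Fin g ⊕ Fin g) (Fin g ⊕ Fin g) ℤ, InK N ∧ St S (N * X) ∧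
      ∀ r, (N * X) r (Sum.inl j) = if r = Sum.inl j then 1 else 0 := by
  have hp' : ∀ i ∈ S, p ≠ Sum.inr i := by
    rintro i hi rfl; exact hp hi
  obtain ⟨N, hN, hSt, e, he⟩ := h.op (Sum.inl j) p hpj.symm u hp (by simp)
  have he' : ∀ r, (N * X) r (Sum.inl j) = (if r = p then u else 0) +
      (if r = Sum.inl j then 1 else 0) := by
    intro r
    rw [he, hX, hX, hX, if_pos rfl, hu]
    have : (if r = p.swap ∧ p ≠ (Sum.inl j : Fin g ⊕ Fin g).swap then
      e * (if (Sum.inl j : Fin g ⊕ Fin g).swap = p then u else 0) else 0) = 0 := by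
      split_ifs with h1 h2
      · exact absurd h2.symm h1.2
      · simp
      · rfl
    rw [this, add_zero]
  obtain ⟨N', hN', hSt', e', he2⟩ := hSt.op p (Sum.inl j) hpj (-u) hj hp'
  refine ⟨N' * N, hN'.mul hN, by rwa [Matrix.mul_assoc], ?_⟩
  intro r
  rw [Matrix.mul_assoc, he2, he', he', he', if_neg hpj.symm, if_pos rfl]
  have : (if r = (Sum.inl j : Fin g ⊕ Fin g).swap ∧ Sum.inl j ≠ p.swap then
      e' * ((if p.swap = p then u else 0) + (if p.swap = Sum.inl j then 1 else 0)) else 0) = 0 := by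
    split_ifs with h1 h2 h3 h4
    · exact absurd h2.symm (ne_swap p)
    · exact absurd h2.symm (ne_swap p)
    · exact absurd h4.symm h1.2
    · simp
    · rfl
  rw [this]
  split_ifs <;> simp

theorem St.finish {S : Finset (Fin g)} {X : Matrix (Fin g ⊕ Fin g) (Fin g ⊕ Fin g) ℤ} (h : St S X)
    {j : Fin g} (hj : j ∉ S) (p : Fin g ⊕ Fin g) (hp : idx p ∉ S) (u : ℤ)
    (hu : u * u = 1) (hX : ∀ r, X r (Sum.inl j) = if r = p then u else 0) :
    ∃ N : Matrix (Fin g ⊕ Fin g) (Fin g ⊕ Fin g) ℤ, InK N ∧ St S (N * X) ∧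
      ∀ r, (N * X) r (Sum.inl j) = if r = Sum.inl j then 1 else 0 := by
  by_cases hpj : p = Sum.inl j
  · subst hpj
    have hj' : ∀ i ∈ S, (Sum.inr j : Fin g ⊕ Fin g) ≠ Sum.inr i := by
      rintro i hi h; exact hj (Sum.inr_injective h ▸ hi)
    obtain ⟨N, hN, hSt, e, he⟩ := h.op (Sum.inr j) (Sum.inl j) (by simp) 1 hj hj'
    obtain ⟨N', hN', hSt', e', he'⟩ := hSt.op (Sum.inl j) (Sum.inr j) (by simp) (-1) hj (by simp)
    obtain ⟨N2, hN2, hSt2, h2⟩ := hSt'.finish1 hj (Sum.inr j) (by simp) hj u hu (by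
      intro r
      simp [he', he, hX]
      rcases r with r | r <;> simp <;> split_ifs <;> simp)
    refine ⟨N2 * N' * N, (hN2.mul hN').mul hN, ?_, ?_⟩
    · simpa only [Matrix.mul_assoc] using hSt2
    · simpa only [Matrix.mul_assoc] using h2
  · exact h.finish1 hj p hpj hp u hu hX

theorem St.step (S : Finset (Fin g)) {j : Fin g} (hj : j ∉ S) (n : ℕ) :
    ∀ X : Matrix (Fin g ⊕ Fin g) (Fin g ⊕ Fin g) ℤ, St S X → meas X j = n →
    ∃ N : Matrix (Fin g ⊕ Fin g) (Fin g ⊕ Fin g) ℤ, InK N ∧ St S (N * X) ∧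
      ∀ r, (N * X) r (Sum.inl j) = if r = Sum.inl j then 1 else 0 := by
  induction n using Nat.strong_induction_on with
  | _ n ih =>
  intro X h hn
  by_cases hred : ∃ p q : Fin g ⊕ Fin g, p ≠ q ∧ idx q ∉ S ∧ X q (Sum.inl j) ≠ 0 ∧
      |X q (Sum.inl j)| ≤ |X p (Sum.inl j)| ∧ (q = p.swap ∨ X p.swap (Sum.inl j) = 0)
  · obtain ⟨p, q, hpq, hq, hq0, hle, hs⟩ := hred
    obtain ⟨N, hN, hSt, hlt⟩ := h.reduce hj p q hpq hq hq0 hle hs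
    obtain ⟨N', hN', hSt', h'⟩ := ih _ (hn ▸ hlt) _ hSt rfl
    refine ⟨N' * N, hN'.mul hN, ?_, ?_⟩
    · simpa only [Matrix.mul_assoc] using hSt'
    · simpa only [Matrix.mul_assoc] using h'
  · push Not at hred
    have hrow : ∀ i ∈ S, X (Sum.inr i) (Sum.inl j) = 0 := by
      intro i hi
      have h0 := h.row hi (Sum.inl j)
      simpa [Jmat] using h0
    have A1 : ∀ p, idx p ∉ S → X p (Sum.inl j) ≠ 0 → X p.swap (Sum.inl j) = 0 := by
      intro p hp hp0
      by_contra hs0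
      rcases le_total |X p (Sum.inl j)| |X p.swap (Sum.inl j)| with hl | hl
      · exact (hred p.swap p (ne_swap p).symm hp hp0 hl).1 (by simp)
      · exact (hred p p.swap (ne_swap p) (by simpa using hp) hs0 hl).1 rfl
    have A2 : ∀ p q, idx p ∉ S → idx q ∉ S → X p (Sum.inl j) ≠ 0 → X q (Sum.inl j) ≠ 0 →
        p = q := by
      intro p q hp hq hp0 hq0
      by_contra hpq
      rcases le_total |X p (Sum.inl j)| |X q (Sum.inl j)| with hl | hl
      · exact (hred q p (Ne.symm hpq) hp hp0 hl).2 (A1 q hq hq0)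
      · exact (hred p q hpq hq hq0 hl).2 (A1 p hp hp0)
    obtain ⟨q, hq, hq0⟩ : ∃ q, idx q ∉ S ∧ X q (Sum.inl j) ≠ 0 := by
      by_contra hno
      push Not at hno
      have := h.prim hj 0 (fun i hi => ⟨by rw [hno (Sum.inl i) hi], by rw [hno (Sum.inr i) hi]⟩)
      simp at this
    have hdiv : X q (Sum.inl j) ∣ 1 := by
      have hall : ∀ r, idx r ∉ S → X q (Sum.inl j) ∣ X r (Sum.inl j) := by
        intro r hr
        by_cases hr0 : X r (Sum.inl j) = 0
        · rw [hr0]; exact dvd_zero _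
        · rw [A2 q r hq hr hq0 hr0]
      exact h.prim hj _ (fun i hi => ⟨hall _ hi, hall _ hi⟩)
    have hu : IsUnit (X q (Sum.inl j)) := isUnit_of_dvd_one hdiv
    refine h.finish hj q hq (X q (Sum.inl j)) (Int.isUnit_mul_self hu) ?_
    intro r
    split_ifs with hr
    · rw [hr]
    by_contra hr0
    by_cases hrS : idx r ∈ S
    · rcases r with r | r
      · refine (hred (Sum.inl r) q hr hq hq0 ?_).2 (hrow r hrS)
        rw [Int.isUnit_iff_abs_eq.mp hu]
        exact Int.one_le_abs hr0
      · exact hr0 (hrow r hrS)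
    · exact hr (A2 r q hrS hq hr0 hq0)

theorem St.exists {X : Matrix (Fin g ⊕ Fin g) (Fin g ⊕ Fin g) ℤ} (hX : IsSymplectic X)
    (S : Finset (Fin g)) : ∃ N : Matrix (Fin g ⊕ Fin g) (Fin g ⊕ Fin g) ℤ, InK N ∧ St S (N * X) := by
  induction S using Finset.induction_on with
  | empty => exact ⟨1, InK.one, by simpa [St] using hX⟩
  | insert j S hj ih =>
    obtain ⟨N, hN, hSt⟩ := ih
    obtain ⟨N', hN', hSt', h'⟩ := St.step S hj _ _ hSt rfl
    refine ⟨N' * N, hN'.mul hN, ?_⟩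
    rw [Matrix.mul_assoc]
    refine ⟨hSt'.1, ?_⟩
    intro i hi
    rcases Finset.mem_insert.mp hi with rfl | hi
    · exact h'
    · exact hSt'.2 i hi

theorem St.univ {X : Matrix (Fin g ⊕ Fin g) (Fin g ⊕ Fin g) ℤ} (h : St Finset.univ X) : InK X := by
  have h11 : X.toBlocks₁₁ = 1 := by
    ext a b
    simp [toBlocks₁₁, h.2 b (Finset.mem_univ _), Matrix.one_apply]
  have h21 : X.toBlocks₂₁ = 0 := by
    ext a b
    simp [toBlocks₂₁, h.2 b (Finset.mem_univ _)]
  have h22 : X.toBlocks₂₂ = 1 := by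
    ext a b
    simp [toBlocks₂₂, h.row (Finset.mem_univ a), Jmat]
  have hb : X = fromBlocks 1 X.toBlocks₁₂ 0 1 := by
    conv_lhs => rw [← fromBlocks_toBlocks X, h11, h21, h22]
  rw [hb]
  apply inK_T
  have hs := h.1
  rw [hb] at hs
  simp only [IsSymplectic, Jmat, fromBlocks_transpose, fromBlocks_multiply, fromBlocks_inj] at hs
  have := hs.2.2.2
  simp at this
  exact (add_neg_eq_zero.mp (by simpa [add_comm] using this)) 

end Helpers

/-- `Sp(2g,ℤ)` is generated, as a group, by `J_{2g}`, the matrices `D_A` for `A ∈ GL(g,ℤ)`,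
and the matrices `T_B` for symmetric integer `B`. -/
theorem stmt5 (g : ℕ) :
    Subgroup.closure {x : Sp g |
      ((x : (Matrix (Fin g ⊕ Fin g) (Fin g ⊕ Fin g) ℤ)ˣ) : Matrix _ _ ℤ) = Jmat g ∨
      (∃ A : Matrix (Fin g) (Fin g) ℤ, IsUnit A ∧
        ((x : (Matrix (Fin g ⊕ Fin g) (Fin g ⊕ Fin g) ℤ)ˣ) : Matrix _ _ ℤ) = Dmat A) ∨
      (∃ B : Matrix (Fin g) (Fin g) ℤ, Bᵀ = B ∧
        ((x : (Matrix (Fin g ⊕ Fin g) (Fin g ⊕ Fin g) ℤ)ˣ) : Matrix _ _ ℤ) = Tmat B)} = ⊤ := by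
  rw [eq_top_iff]
  intro x _
  obtain ⟨N, hN, hSt⟩ := St.exists x.2 Finset.univ
  obtain ⟨y, hy, hyx⟩ := inK_of_mul hN hSt.univ
  have : y = x := Subtype.ext (Units.ext hyx)
  exact this ▸ hy
end

section
/- Let M ∈ Sp(2g,ℤ) with block decomposition M = [[A,B],[C,D]] into integer g×g blocks, and let τ be a g×g complex matrix that is symmetric with positive definite imaginary part (a Riemann matrix). Then (i) the complex matrix Cτ + D is invertible, and (ii) the matrix M·τ := (Aτ + B)(Cτ + D)⁻¹ is again symmetric with positive definite imaginary part. -/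
open Matrix

/-- Canonical embedding of integer matrices into complex matrices. -/
def ic {g : ℕ} (A : Matrix (Fin g) (Fin g) ℤ) : Matrix (Fin g) (Fin g) ℂ :=
  A.map (fun n => (n : ℂ))

lemma re_pos_aux {g : ℕ} {Y : Matrix (Fin g) (Fin g) ℝ} (hY : Y.PosDef) {x : Fin g → ℂ}
    (hx : x ≠ 0) : 0 < (star x ⬝ᵥ (Y.map Complex.ofReal *ᵥ x)).re := by
  have key : (star x ⬝ᵥ (Y.map Complex.ofReal *ᵥ x)).re
      = star (fun i => (x i).re) ⬝ᵥ (Y *ᵥ fun i => (x i).re)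
        + star (fun i => (x i).im) ⬝ᵥ (Y *ᵥ fun i => (x i).im) := by
    simp only [dotProduct, mulVec, Finset.mul_sum, Complex.re_sum, ← Finset.sum_add_distrib]
    refine Finset.sum_congr rfl fun i _ => Finset.sum_congr rfl fun j _ => ?_
    simp
  rw [key]
  by_cases hu : (fun i => (x i).re) = 0
  · have hv : (fun i => (x i).im) ≠ 0 := by
      intro hv
      apply hx
      funext i
      exact Complex.ext (congrFun hu i) (congrFun hv i)
    exact add_pos_of_nonneg_of_pos (hY.posSemidef.dotProduct_mulVec_nonneg _)
      (hY.dotProduct_mulVec_pos hv)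
  · exact add_pos_of_pos_of_nonneg (hY.dotProduct_mulVec_pos hu)
      (hY.posSemidef.dotProduct_mulVec_nonneg _)

lemma sub_conj_aux {g : ℕ} {Z : Matrix (Fin g) (Fin g) ℂ} (h : Zᵀ = Z) :
    Z - Zᴴ = (2 * Complex.I) • (Z.map Complex.im).map Complex.ofReal := by
  ext i j
  have hij : Z j i = Z i j := congrFun (congrFun h i) j
  simp only [Matrix.sub_apply, conjTranspose_apply, hij, Matrix.smul_apply, map_apply, smul_eq_mul]
  apply Complex.ext <;> simp
  ring

lemma ic_conj {g : ℕ} (A : Matrix (Fin g) (Fin g) ℤ) : (ic A)ᴴ = (ic A)ᵀ := by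
  ext i j
  simp [ic]

lemma ic_eq {g : ℕ} (A : Matrix (Fin g) (Fin g) ℤ) :
    ic A = (Int.castRingHom ℂ).mapMatrix A := rfl

lemma ic_tr {g : ℕ} (A : Matrix (Fin g) (Fin g) ℤ) : ic Aᵀ = (ic A)ᵀ := rfl

lemma rels {g : ℕ} {A B C D : Matrix (Fin g) (Fin g) ℤ}
    (hM : IsSymplectic (Matrix.fromBlocks A B C D)) :
    (ic C)ᵀ * ic A = (ic A)ᵀ * ic C ∧ (ic D)ᵀ * ic B = (ic B)ᵀ * ic D ∧
    (ic A)ᵀ * ic D = 1 + (ic C)ᵀ * ic B ∧ (ic D)ᵀ * ic A = 1 + (ic B)ᵀ * ic C := by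
  have hJ : Jmat g = - J (Fin g) ℤ := by
    simp [Jmat, J, fromBlocks_neg]
  have h : fromBlocks A B C D ∈ symplecticGroup (Fin g) ℤ := by
    rw [SymplecticGroup.mem_iff']
    have := hM
    rw [IsSymplectic, hJ] at this
    simpa using this
  obtain ⟨h1, h2, h3⟩ := SymplecticGroup.fromBlocks_mem_iff.1 h
  have h3' : Aᵀ * D = 1 + Cᵀ * B := by rw [← h3]; abel
  have h4 : Dᵀ * A = 1 + Bᵀ * C := by
    have := congrArg transpose h3'
    simpa using this
  refine ⟨?_, ?_, ?_, ?_⟩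
  · simp only [← ic_tr]
    simp only [ic_eq, ← map_mul, h1]
  · simp only [← ic_tr]
    simp only [ic_eq, ← map_mul, h2]
  · simp only [← ic_tr]
    simp only [ic_eq, ← map_mul, h3', map_add, map_one]
  · simp only [← ic_tr]
    simp only [ic_eq, ← map_mul, h4, map_add, map_one]

/-- Common computation: `S` is either the transpose or the conjugate transpose of `τ`. -/
lemma comp_aux {g : ℕ} {a b c d S τ : Matrix (Fin g) (Fin g) ℂ}
    (h1 : cᵀ * a = aᵀ * c) (h2 : dᵀ * b = bᵀ * d) (h3 : aᵀ * d = 1 + cᵀ * b)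
    (h4 : dᵀ * a = 1 + bᵀ * c) :
    (S * cᵀ + dᵀ) * (a * τ + b) - (S * aᵀ + bᵀ) * (c * τ + d) = τ - S := by
  have e1 : (S * cᵀ + dᵀ) * (a * τ + b)
      = S * (cᵀ * a) * τ + S * (cᵀ * b) + (dᵀ * a) * τ + dᵀ * b := by noncomm_ring
  have e2 : (S * aᵀ + bᵀ) * (c * τ + d)
      = S * (aᵀ * c) * τ + S * (aᵀ * d) + (bᵀ * c) * τ + bᵀ * d := by noncomm_ring
  rw [e1, e2, h1, h2, h3, h4]
  noncomm_ring

/-- For `M = [[A,B],[C,D]] ∈ Sp(2g,ℤ)` and a Riemann matrix `τ` (symmetric with positive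
definite imaginary part), `Cτ + D` is invertible, and `M·τ = (Aτ+B)(Cτ+D)⁻¹` is again
symmetric with positive definite imaginary part. -/
theorem stmt7 (g : ℕ) (A B C D : Matrix (Fin g) (Fin g) ℤ)
    (hM : IsSymplectic (Matrix.fromBlocks A B C D))
    (τ : Matrix (Fin g) (Fin g) ℂ) (hsymm : τᵀ = τ)
    (hpos : (τ.map Complex.im).PosDef) :
    IsUnit (ic C * τ + ic D) ∧
    ((ic A * τ + ic B) * (ic C * τ + ic D)⁻¹)ᵀ = (ic A * τ + ic B) * (ic C * τ + ic D)⁻¹ ∧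
    (((ic A * τ + ic B) * (ic C * τ + ic D)⁻¹).map Complex.im).PosDef := by
  obtain ⟨h1, h2, h3, h4⟩ := rels hM
  have hT := comp_aux (S := τ) (τ := τ) h1 h2 h3 h4
  have hH := comp_aux (S := τᴴ) (τ := τ) h1 h2 h3 h4
  rw [sub_conj_aux hsymm] at hH
  set P := ic A * τ + ic B with hP
  set Q := ic C * τ + ic D with hQ
  have ePT : τ * (ic A)ᵀ + (ic B)ᵀ = Pᵀ := by simp [hP, hsymm]
  have eQT : τ * (ic C)ᵀ + (ic D)ᵀ = Qᵀ := by simp [hQ, hsymm]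
  have ePH : τᴴ * (ic A)ᵀ + (ic B)ᵀ = Pᴴ := by simp [hP, ic_conj]
  have eQH : τᴴ * (ic C)ᵀ + (ic D)ᵀ = Qᴴ := by simp [hQ, ic_conj]
  rw [ePT, eQT, sub_self, sub_eq_zero] at hT
  rw [ePH, eQH] at hH
  have h2I : (2 * Complex.I) ≠ 0 := by simp
  have hU : IsUnit Q := by
    rw [← mulVec_injective_iff_isUnit]
    refine (injective_iff_map_eq_zero Q.mulVecLin).2 fun x hx => ?_
    rw [mulVecLin_apply] at hx
    by_contra hne
    have hp := re_pos_aux hpos hne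
    have : star x ⬝ᵥ ((Qᴴ * P - Pᴴ * Q) *ᵥ x) = 0 := by
      rw [sub_mulVec, dotProduct_sub, ← mulVec_mulVec, ← mulVec_mulVec, hx, dotProduct_mulVec,
        ← star_mulVec, hx]
      simp
    rw [hH, smul_mulVec, dotProduct_smul, smul_eq_zero] at this
    rw [this.resolve_left h2I] at hp
    simp at hp
  have hd : IsUnit Q.det := (isUnit_iff_isUnit_det Q).1 hU
  have hZQ : P * Q⁻¹ * Q = P := nonsing_inv_mul_cancel_right _ _ hd
  have hs : (P * Q⁻¹)ᵀ = P * Q⁻¹ := by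
    have hUT : IsUnit Qᵀ := by rwa [isUnit_transpose]
    apply hU.mul_right_cancel
    apply hUT.mul_left_cancel
    rw [hZQ, hT, ← Matrix.mul_assoc, ← transpose_mul, hZQ]
  refine ⟨hU, hs, ?_⟩
  have hc := sub_conj_aux hs
  generalize hZ : P * Q⁻¹ = Z at *
  have hY : Qᴴ * (Z.map Complex.im).map Complex.ofReal * Q
      = (τ.map Complex.im).map Complex.ofReal := by
    apply smul_right_injective _ h2I
    change (2 * Complex.I) • _ = (2 * Complex.I) • _
    rw [← hH, ← Matrix.smul_mul, ← Matrix.mul_smul, ← hc, ← hZQ, conjTranspose_mul]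
    noncomm_ring
  refine .of_dotProduct_mulVec_pos ?_ fun w hw => ?_
  · ext i j
    have := congrFun (congrFun hs i) j
    simpa using congrArg Complex.im this
  · set W : Fin g → ℂ := fun i => (w i : ℂ) with hW
    have hx : Q *ᵥ (Q⁻¹ *ᵥ W) = W := by
      rw [mulVec_mulVec, mul_nonsing_inv _ hd, one_mulVec]
    have hne : Q⁻¹ *ᵥ W ≠ 0 := by
      intro h0
      rw [h0, mulVec_zero] at hx
      apply hw
      funext i
      simpa [hW] using (congrFun hx i).symm
    have hp := re_pos_aux hpos hne
    rw [← hY, ← mulVec_mulVec, ← mulVec_mulVec, dotProduct_mulVec, ← star_mulVec, hx] at hp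
    have key : (star W ⬝ᵥ ((Z.map Complex.im).map Complex.ofReal *ᵥ W)).re
        = star w ⬝ᵥ (Z.map Complex.im *ᵥ w) := by
      simp [hW, dotProduct, mulVec, Complex.re_sum, Finset.mul_sum]
    rwa [key] at hp
end

section
/- For every g ≥ 1, the automorphism group of the free group F_g on g generators is generated by the elementary Nielsen transformations. Precisely, let F be the free group on the index set {1,…,g} with free generators x₁,…,x_g. Then the subgroup of Aut(F) generated by the set of all automorphisms α of one of the following three kinds equals all of Aut(F): (i) permutations: there is a permutation π of {1,…,g} with α(x_i) = x_{π(i)} for all i; (ii) inversions: there is an index k with α(x_k) = x_k⁻¹ and α(x_i) = x_i for all i ≠ k; (iii) replacements by product: there are distinct indices k ≠ ℓ with α(x_k) = x_k x_ℓ and α(x_i) = x_i for all i ≠ k. -/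
namespace Nielsen10

open FreeGroup

/-- Length of the longest common prefix of two lists. -/
def lcp {A : Type} [DecidableEq A] : List A → List A → ℕ
  | a :: l, b :: m => if a = b then lcp l m + 1 else 0
  | [], _ => 0
  | _ :: _, [] => 0

section lcp
variable {A : Type} [DecidableEq A]

theorem lcp_comm (l m : List A) : lcp l m = lcp m l := by
  induction l generalizing m with
  | nil => cases m <;> simp [lcp]
  | cons a l ih => cases m <;> simp [lcp, ih, eq_comm]

theorem lcp_self (l : List A) : lcp l l = l.length := by
  induction l with
  | nil => simp [lcp]
  | cons a l ih => simp [lcp, ih]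

theorem lcp_take (l m : List A) (k : ℕ) (hk : k ≤ lcp l m) : l.take k = m.take k := by
  induction l generalizing m k with
  | nil => simp [lcp] at hk; simp [hk]
  | cons a l ih =>
    cases m with
    | nil => simp [lcp] at hk; simp [hk]
    | cons b m =>
      cases k with
      | zero => simp
      | succ k =>
        simp only [lcp] at hk
        split_ifs at hk with h
        · simp [h, ih m k (by omega)]
        · omega

theorem lcp_ultra (x y z : List A) (h : lcp x y < lcp y z) : lcp x z = lcp x y := by
  induction x generalizing y z with
  | nil => simp [lcp]
  | cons a x ih =>
    cases y with
    | nil => simp [lcp] at h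
    | cons b y =>
      cases z with
      | nil => simp [lcp] at h
      | cons c z =>
        simp only [lcp] at h ⊢
        by_cases hbc : b = c
        · subst hbc
          by_cases hab : a = b
          · subst hab
            simp at h ⊢
            exact ih y z h
          · simp [hab]
        · simp [hbc] at h

end lcp

variable {g : ℕ}

/-- The inverse letter. -/
def il (a : Fin g × Bool) : Fin g × Bool := (a.1, !a.2)

theorem invRev_singleton (a : Fin g × Bool) : invRev [a] = [il a] := by
  simp [invRev, il]

theorem isReduced_invRev {l : List (Fin g × Bool)} (h : IsReduced l) : IsReduced (invRev l) := by
  rw [isReduced_iff_reduce_eq] at h ⊢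
  rw [reduce_invRev, h]

/-- Gromov product formula at the level of words. -/
theorem length_words (l m : List (Fin g × Bool)) (hl : IsReduced l) (hm : IsReduced m) :
    norm ((mk l)⁻¹ * mk m) + 2 * lcp l m = l.length + m.length := by
  induction l generalizing m with
  | nil =>
    have : norm (mk m) = m.length := by rw [FreeGroup.norm, toWord_mk, hm.reduce_eq]
    simp [lcp, ← FreeGroup.one_eq_mk, this]
  | cons a l ih =>
    cases m with
    | nil =>
      have : norm (mk (a :: l)) = (a :: l).length := by rw [FreeGroup.norm, toWord_mk, hl.reduce_eq]
      rw [← FreeGroup.one_eq_mk, mul_one, norm_inv_eq, this]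
      simp [lcp]
    | cons b m =>
      by_cases hab : a = b
      · subst hab
        have e1 : ∀ l : List (Fin g × Bool), mk (a :: l) = mk [a] * mk l := by
          intro l; rw [mul_mk]; rfl
        have := ih m (hl.infix ⟨[a], [], by simp⟩) (hm.infix ⟨[a], [], by simp⟩)
        rw [e1 l, e1 m]
        have e2 : (mk [a] * mk l)⁻¹ * (mk [a] * mk m) = (mk l)⁻¹ * mk m := by group
        rw [e2]
        simp only [lcp, if_true, List.length_cons]
        omega
      · simp only [lcp, hab, if_false]
        rw [inv_mk, mul_mk]
        have hr : IsReduced (invRev (a :: l) ++ b :: m) := by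
          have h1 := isReduced_invRev hl
          rw [invRev_cons, invRev_singleton] at h1 ⊢
          refine IsReduced.append_overlap (L₂ := [il a]) h1 ?_ (by simp)
          simp only [List.singleton_append, isReduced_cons_cons]
          refine ⟨?_, hm⟩
          intro h
          obtain ⟨a1, a2⟩ := a
          obtain ⟨b1, b2⟩ := b
          simp [il] at h ⊢
          subst h
          simp at hab
          cases a2 <;> cases b2 <;> simp_all
        rw [FreeGroup.norm, toWord_mk, hr.reduce_eq]
        simp

/-- common prefix length of two elements -/
def cp (x y : FreeGroup (Fin g)) : ℕ := lcp x.toWord y.toWord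

theorem cp_formula (x y : FreeGroup (Fin g)) : norm (x⁻¹ * y) + 2 * cp x y = norm x + norm y := by
  have := length_words x.toWord y.toWord isReduced_toWord isReduced_toWord
  simpa [mk_toWord, cp, FreeGroup.norm] using this

theorem cp_formula' (x y : FreeGroup (Fin g)) : norm (x * y) + 2 * cp x⁻¹ y = norm x + norm y := by
  have := cp_formula x⁻¹ y
  simpa using this

theorem cp_comm (x y : FreeGroup (Fin g)) : cp x y = cp y x := lcp_comm _ _

theorem cp_mul (x y : FreeGroup (Fin g)) : cp x (x * y) + cp x⁻¹ y = norm x := by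
  have h1 := cp_formula x (x * y)
  have h2 := cp_formula' x y
  simp at h1
  omega

theorem cp_ultra (x y z : FreeGroup (Fin g)) (h : cp x y < cp y z) : cp x z = cp x y :=
  lcp_ultra _ _ _ h

theorem cp_self_inv (x : FreeGroup (Fin g)) (hx : x ≠ 1) : 2 * cp x⁻¹ x < norm x := by
  by_contra! hc
  apply hx
  have ht := lcp_take _ _ _ (le_refl (cp x⁻¹ x))
  set m := cp x⁻¹ x with hm
  rw [toWord_inv] at ht
  obtain ⟨p, s, hp, hs, hl⟩ : ∃ p s, p = x.toWord.take m ∧ s = x.toWord.drop m ∧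
    x.toWord = p ++ s := ⟨_, _, rfl, rfl, by simp⟩
  have hml : m ≤ norm x := by
    have h1 := cp_formula' x x
    have h2 := norm_mul_le x⁻¹ (x * x)
    simp at h2
    omega
  have hpl : p.length = m := by rw [hp, List.length_take]; exact min_eq_left hml
  have hsl : s.length + m = norm x := by
    rw [FreeGroup.norm, hl, List.length_append, hpl, add_comm]
  have hsp : s.length ≤ p.length := by omega
  rw [← hp, hl, invRev_append] at ht
  rw [List.take_append, invRev_length, List.take_of_length_le (by simp; omega)] at ht
  obtain ⟨t, htd⟩ : ∃ t, t = List.take (m - s.length) (invRev p) := ⟨_, rfl⟩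
  rw [← htd] at ht
  have htl : t.length = m - s.length := by rw [htd]; simp; omega
  rw [← ht, invRev_append, invRev_invRev, List.take_append_of_le_length (by simp; omega),
    List.take_of_length_le (by simp; omega)] at htd
  have h1 : mk t = (mk t)⁻¹ := by rw [inv_mk, ← htd]
  have h2 : mk t = 1 := by
    have h3 : (mk t) ^ 2 = 1 := by
      rw [pow_two]; nth_rewrite 1 [h1]; group
    exact (pow_eq_one_iff_left (by norm_num)).1 h3
  rw [← mk_toWord (x := x), hl, ← ht, ← mul_mk, ← mul_mk, h2, ← inv_mk]
  group

theorem toWord_of_norm (l : List (Fin g × Bool)) (h : norm (mk l) = l.length) :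
    (mk l).toWord = l := by
  have : List.Sublist (reduce l) l := (reduce.red).sublist
  rw [toWord_mk]
  apply this.eq_of_length
  rwa [FreeGroup.norm, toWord_mk] at h

/-- numerical code of a word -/
def code (l : List (Fin g × Bool)) : ℕ :=
  Nat.ofDigits (2 * g + 2) ((l.map fun a => 2 * (a.1 : ℕ) + a.2.toNat).reverse)

theorem code_append (p c : List (Fin g × Bool)) :
    code (p ++ c) = code c + (2 * g + 2) ^ c.length * code p := by
  simp [code, Nat.ofDigits_append]

theorem code_inj (p q : List (Fin g × Bool)) (h : p.length = q.length) (hc : code p = code q) :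
    p = q := by
  unfold code at hc
  have hb : ∀ (l : List (Fin g × Bool)),
      ∀ x ∈ (l.map fun a => 2 * (a.1 : ℕ) + a.2.toNat).reverse, x < 2 * g + 2 := by
    intro l x hx
    simp only [List.mem_reverse, List.mem_map] at hx
    obtain ⟨a, _, rfl⟩ := hx
    have h1 := a.1.2
    have h2 := a.2.toNat_le
    omega
  have := Nat.ofDigits_inj_of_len_eq (by omega) (by simpa using h) (hb p) (hb q) hc
  rw [List.reverse_inj] at this
  refine List.map_injective_iff.2 ?_ this
  rintro ⟨a, b⟩ ⟨c, d⟩ h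
  have : (a : ℕ) = c ∧ b = d := by
    cases b <;> cases d <;> simp at h ⊢ <;> omega
  ext <;> simp [this]

/-- code of the initial half -/
def hcode (x : FreeGroup (Fin g)) : ℕ := code (x.toWord.take (norm x / 2))

/-- the potential -/
def pot (x : FreeGroup (Fin g)) : ℕ ×ₗ ℕ := toLex (norm x, hcode x + hcode x⁻¹)

theorem pot_inv (x : FreeGroup (Fin g)) : pot x⁻¹ = pot x := by
  simp [pot, norm_inv_eq, add_comm]

theorem half_word (x : FreeGroup (Fin g)) (m : ℕ) (hm : norm x = 2 * m) :
    x.toWord = x.toWord.take m ++ invRev (x⁻¹.toWord.take m) := by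
  have h : x.toWord.length = 2 * m := hm
  have e : x.toWord = x.toWord.take m ++ x.toWord.drop m := by simp
  have hd : (x.toWord.drop m).length = m := by simp; omega
  have : x⁻¹.toWord.take m = invRev (x.toWord.drop m) := by
    rw [toWord_inv]
    conv_lhs => rw [e, invRev_append]
    rw [List.take_append_of_le_length (by simp; omega)]
    rw [List.take_of_length_le (by simp; omega)]
  rw [this, invRev_invRev, ← e]

theorem pot_lt (x y : FreeGroup (Fin g)) (m : ℕ) (hx : norm x = 2 * m) (hc : cp x⁻¹ y = m)
    (hy : 2 * m ≤ norm y) (hlt : code (x.toWord.take m) < code (x⁻¹.toWord.take m)) :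
    pot (x * y) < pot y := by
  have hn : norm (x * y) = norm y := by
    have := cp_formula' x y
    omega
  have hw := half_word x m hx
  have hpl : (x.toWord.take m).length = m := by
    have h : x.toWord.length = 2 * m := hx
    rw [List.length_take]; omega
  have hql : (x⁻¹.toWord.take m).length = m := by
    have h : x⁻¹.toWord.length = 2 * m := by rw [← hx, ← norm_inv_eq]; rfl
    rw [List.length_take]; omega
  have ht : x⁻¹.toWord.take m = y.toWord.take m := lcp_take _ _ _ hc.ge
  have hyw : y.toWord = x⁻¹.toWord.take m ++ y.toWord.drop m := by rw [ht]; simp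
  generalize x.toWord.take m = p at *
  generalize x⁻¹.toWord.take m = q at *
  generalize y.toWord.drop m = b at *
  have hyl : norm y = m + b.length := by rw [FreeGroup.norm, hyw, List.length_append, hql]
  have hxy : x * y = mk (p ++ b) := by
    rw [← mk_toWord (x := x), ← mk_toWord (x := y), hw, hyw, ← mul_mk, ← mul_mk, ← mul_mk,
      ← inv_mk]
    group
  have hxyw : (x * y).toWord = p ++ b := by
    rw [hxy]
    apply toWord_of_norm
    rw [← hxy, hn, List.length_append, hpl, hyl]
  rw [pot, pot, Prod.Lex.toLex_lt_toLex]
  right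
  refine ⟨hn, ?_⟩
  have h1 : hcode (x * y)⁻¹ = hcode y⁻¹ := by
    rw [hcode, hcode, toWord_inv, toWord_inv, hxyw, hyw, norm_inv_eq, norm_inv_eq, hn,
      invRev_append, invRev_append, List.take_append_of_le_length (by simp; omega),
      List.take_append_of_le_length (by simp; omega)]
  have h2 : hcode (x * y) < hcode y := by
    rw [hcode, hcode, hxyw, hyw, hn, List.take_append, List.take_append, hpl, hql,
      List.take_of_length_le (l := p) (by omega), List.take_of_length_le (l := q) (by omega),
      code_append,
      code_append]
    have h3 : norm y / 2 - m ≤ b.length := by omega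
    have := Nat.mul_lt_mul_of_pos_left hlt
      (Nat.pow_pos (n := (List.take (norm y / 2 - m) b).length) (show 0 < 2 * g + 2 by omega))
    omega
  show _ + _ < _ + _
  omega


/-- image of a letter -/
def v (ψ : MulAut (FreeGroup (Fin g))) (a : Fin g × Bool) : FreeGroup (Fin g) := ψ (mk [a])

theorem v_il (ψ : MulAut (FreeGroup (Fin g))) (a : Fin g × Bool) : v ψ (il a) = (v ψ a)⁻¹ := by
  rw [v, v, ← _root_.map_inv, inv_mk, invRev_singleton]

theorem il_il (a : Fin g × Bool) : il (il a) = a := by simp [il]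

theorem v_ne_one (ψ : MulAut (FreeGroup (Fin g))) (a : Fin g × Bool) : v ψ a ≠ 1 := by
  rw [v, Ne, map_eq_one_iff _ ψ.injective, ← FreeGroup.norm_eq_zero, FreeGroup.norm, toWord_mk]
  simp [reduce_singleton]

theorem norm_v_pos (ψ : MulAut (FreeGroup (Fin g))) (a : Fin g × Bool) : 0 < norm (v ψ a) := by
  have := v_ne_one ψ a
  rw [Ne, ← FreeGroup.norm_eq_zero] at this
  omega

theorem red_iff (a b : Fin g × Bool) : (a.1 = b.1 → a.2 = b.2) ↔ b ≠ il a := by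
  obtain ⟨a1, a2⟩ := a
  obtain ⟨b1, b2⟩ := b
  cases a2 <;> cases b2 <;> simp [il, eq_comm]

/-- first Nielsen condition -/
def N1 (ψ : MulAut (FreeGroup (Fin g))) : Prop := ∀ a b : Fin g × Bool, b ≠ il a →
  2 * cp (v ψ a)⁻¹ (v ψ b) ≤ norm (v ψ a) ∧ 2 * cp (v ψ a)⁻¹ (v ψ b) ≤ norm (v ψ b)

/-- second Nielsen condition -/
def N2 (ψ : MulAut (FreeGroup (Fin g))) : Prop := ∀ a b c : Fin g × Bool, b ≠ il a → c ≠ il b →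
  cp (v ψ a)⁻¹ (v ψ b) + cp (v ψ b)⁻¹ (v ψ c) < norm (v ψ b)

theorem map_cons (ψ : MulAut (FreeGroup (Fin g))) (a : Fin g × Bool) (L : List (Fin g × Bool)) :
    ψ (mk (a :: L)) = v ψ a * ψ (mk L) := by
  rw [v, ← _root_.map_mul, mul_mk]; rfl

theorem cp_word (ψ : MulAut (FreeGroup (Fin g))) (h2 : N2 ψ)
    (L : List (Fin g × Bool)) : ∀ a b : Fin g × Bool, IsReduced (b :: a :: L) →
    cp (v ψ b)⁻¹ (ψ (mk (a :: L))) = cp (v ψ b)⁻¹ (v ψ a) := by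
  induction L with
  | nil => intro a b _; rfl
  | cons a' L ih =>
    intro a b h
    rw [isReduced_cons_cons, red_iff] at h
    have h3 := h.2
    rw [isReduced_cons_cons, red_iff] at h3
    have e := ih a' a h.2
    have e2 := cp_mul (v ψ a) (ψ (mk (a' :: L)))
    have e3 := h2 b a a' h.1 h3.1
    rw [map_cons]
    apply cp_ultra
    omega

theorem norm_word (ψ : MulAut (FreeGroup (Fin g))) (h1 : N1 ψ) (h2 : N2 ψ)
    (L : List (Fin g × Bool)) : ∀ a b : Fin g × Bool, IsReduced (b :: a :: L) →
    2 ≤ norm (ψ (mk (b :: a :: L))) := by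
  induction L with
  | nil =>
    intro a b h
    have e := cp_word ψ h2 _ a b h
    rw [isReduced_cons_cons, red_iff] at h
    have e1 := h1 b a h.1
    rw [map_cons]
    have e2 := cp_formula' (v ψ b) (ψ (mk [a]))
    have e3 := norm_v_pos ψ a
    have e4 := norm_v_pos ψ b
    change _ = _ + norm (v ψ a) at e2
    omega
  | cons a' L ih =>
    intro a b h
    have e := cp_word ψ h2 _ a b h
    rw [isReduced_cons_cons, red_iff] at h
    have e1 := h1 b a h.1
    have e5 := ih a' a h.2
    rw [map_cons]
    have e2 := cp_formula' (v ψ b) (ψ (mk (a :: a' :: L)))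
    omega

theorem exists_letter (ψ : MulAut (FreeGroup (Fin g))) (h1 : N1 ψ) (h2 : N2 ψ) (j : Fin g) :
    ∃ a, v ψ a = of j := by
  obtain ⟨w, hw⟩ := ψ.surjective (of j)
  have hr : IsReduced w.toWord := isReduced_toWord
  rw [← mk_toWord (x := w)] at hw
  rcases hL : w.toWord with _ | ⟨a, _ | ⟨b, L⟩⟩
  · rw [hL, ← FreeGroup.one_eq_mk, _root_.map_one] at hw
    exact absurd hw.symm (of_ne_one j)
  · rw [hL] at hw
    exact ⟨a, hw⟩
  · rw [hL] at hw hr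
    have := norm_word ψ h1 h2 L b a hr
    rw [hw, norm_of] at this
    omega

/-- elementary Nielsen transformations -/
def gens (g : ℕ) : Set (MulAut (FreeGroup (Fin g))) := {α : MulAut (FreeGroup (Fin g)) |
      (∃ π : Equiv.Perm (Fin g), ∀ i, α (FreeGroup.of i) = FreeGroup.of (π i)) ∨
      (∃ k, α (FreeGroup.of k) = (FreeGroup.of k)⁻¹ ∧
        ∀ i, i ≠ k → α (FreeGroup.of i) = FreeGroup.of i) ∨
      (∃ k ℓ, k ≠ ℓ ∧ α (FreeGroup.of k) = FreeGroup.of k * FreeGroup.of ℓ ∧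
        ∀ i, i ≠ k → α (FreeGroup.of i) = FreeGroup.of i)}

theorem exists_inv (k : Fin g) : ∃ τ ∈ Subgroup.closure (gens g),
    τ (of k) = (of k)⁻¹ ∧ ∀ i, i ≠ k → τ (of i) = of i := by
  let f : FreeGroup (Fin g) →* FreeGroup (Fin g) :=
    FreeGroup.lift fun i => if i = k then (of k)⁻¹ else of i
  have hk : f (of k) = (of k)⁻¹ := by simp [f]
  have hi : ∀ i, i ≠ k → f (of i) = of i := by intro i h; simp [f, h]
  have hff : f.comp f = MonoidHom.id _ := by
    apply FreeGroup.ext_hom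
    intro i
    by_cases h : i = k
    · subst h; simp [hk]
    · simp [hi i h]
  let τ : MulAut (FreeGroup (Fin g)) := MonoidHom.toMulEquiv f f hff hff
  exact ⟨τ, Subgroup.subset_closure (Or.inr (Or.inl ⟨k, hk, hi⟩)), hk, hi⟩

theorem exists_trans (k l : Fin g) (hkl : k ≠ l) : ∃ τ ∈ Subgroup.closure (gens g),
    τ (of k) = of k * of l ∧ ∀ i, i ≠ k → τ (of i) = of i := by
  let f : FreeGroup (Fin g) →* FreeGroup (Fin g) :=
    FreeGroup.lift fun i => if i = k then of k * of l else of i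
  let f' : FreeGroup (Fin g) →* FreeGroup (Fin g) :=
    FreeGroup.lift fun i => if i = k then of k * (of l)⁻¹ else of i
  have hk : f (of k) = of k * of l := by simp [f]
  have hi : ∀ i, i ≠ k → f (of i) = of i := by intro i h; simp [f, h]
  have hk' : f' (of k) = of k * (of l)⁻¹ := by simp [f']
  have hi' : ∀ i, i ≠ k → f' (of i) = of i := by intro i h; simp [f', h]
  have hff : f.comp f' = MonoidHom.id _ := by
    apply FreeGroup.ext_hom
    intro i
    by_cases h : i = k
    · subst h; simp [hk, hk', hi l hkl.symm]
    · simp [hi i h, hi' i h]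
  have hff' : f'.comp f = MonoidHom.id _ := by
    apply FreeGroup.ext_hom
    intro i
    by_cases h : i = k
    · subst h; simp [hk, hk', hi' l hkl.symm]
    · simp [hi i h, hi' i h]
  let τ : MulAut (FreeGroup (Fin g)) := MonoidHom.toMulEquiv f f' hff' hff
  exact ⟨τ, Subgroup.subset_closure (Or.inr (Or.inr ⟨k, l, hkl, hk, hi⟩)), hk, hi⟩

theorem mk_true (k : Fin g) : mk [(k, true)] = of k := rfl
theorem mk_false (k : Fin g) : mk [(k, false)] = (of k)⁻¹ := rfl

theorem exists_trans_inv (k l : Fin g) (hkl : k ≠ l) : ∃ τ ∈ Subgroup.closure (gens g),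
    τ (of k) = of k * (of l)⁻¹ ∧ ∀ i, i ≠ k → τ (of i) = of i := by
  obtain ⟨τ, hτ, h1, h2⟩ := exists_trans k l hkl
  have h3 : ∀ i, i ≠ k → τ⁻¹ (of i) = of i := by
    intro i hi
    rw [MulAut.inv_apply, MulEquiv.symm_apply_eq, h2 i hi]
  refine ⟨τ⁻¹, inv_mem hτ, ?_, h3⟩
  rw [MulAut.inv_apply, MulEquiv.symm_apply_eq, _root_.map_mul, _root_.map_inv, h1, h2 l hkl.symm]
  group

theorem exists_letter_right (k : Fin g) (b : Fin g × Bool) (hkl : k ≠ b.1) :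
    ∃ τ ∈ Subgroup.closure (gens g),
    τ (of k) = of k * mk [b] ∧ ∀ i, i ≠ k → τ (of i) = of i := by
  obtain ⟨l, e⟩ := b
  cases e
  · exact exists_trans_inv k l hkl
  · exact exists_trans k l hkl

theorem mk_fix (τ : MulAut (FreeGroup (Fin g))) (b : Fin g × Bool) (h : τ (of b.1) = of b.1) :
    τ (mk [b]) = mk [b] := by
  obtain ⟨l, e⟩ := b
  cases e
  · rw [mk_false, _root_.map_inv]; simpa using h
  · exact h

theorem exists_letter_left (a b : Fin g × Bool) (hab : a.1 ≠ b.1) :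
    ∃ τ ∈ Subgroup.closure (gens g),
    τ (mk [a]) = mk [b] * mk [a] ∧ ∀ i, i ≠ a.1 → τ (of i) = of i := by
  obtain ⟨k, e⟩ := a
  cases e
  · obtain ⟨τ, hτ, h1, h2⟩ := exists_letter_right k (il b) hab
    refine ⟨τ, hτ, ?_, h2⟩
    rw [mk_false, _root_.map_inv, h1, mul_inv_rev, inv_mk, invRev_singleton, il_il]
  · obtain ⟨τ, hτ, h1, h2⟩ := exists_letter_right k (il b) hab
    obtain ⟨ι, hι, h3, h4⟩ := exists_inv k
    refine ⟨ι * τ * ι, mul_mem (mul_mem hι hτ) hι, ?_, ?_⟩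
    · rw [mk_true, MulAut.mul_apply, MulAut.mul_apply, h3, _root_.map_inv, h1, _root_.map_inv, _root_.map_mul, h3,
        mk_fix ι (il b) (h4 _ hab.symm), mul_inv_rev, inv_mk, invRev_singleton, il_il, inv_inv]
    · intro i hi
      rw [MulAut.mul_apply, MulAut.mul_apply, h4 i hi, h2 i hi, h4 i hi]

/-- total potential -/
def tot (ψ : MulAut (FreeGroup (Fin g))) : ℕ ×ₗ ℕ := ∑ i, pot (ψ (of i))

theorem pot_v (ψ : MulAut (FreeGroup (Fin g))) (a : Fin g × Bool) :
    pot (v ψ a) = pot (ψ (of a.1)) := by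
  obtain ⟨k, e⟩ := a
  cases e
  · rw [v, mk_false, _root_.map_inv, pot_inv]
  · rfl

/-- minimality in the coset -/
def Mini (ψ : MulAut (FreeGroup (Fin g))) : Prop :=
  ∀ τ ∈ Subgroup.closure (gens g), tot ψ ≤ tot (ψ * τ)

theorem mini_pot (ψ : MulAut (FreeGroup (Fin g))) (h : Mini ψ) (a b : Fin g × Bool)
    (hab : a.1 ≠ b.1) : pot (v ψ a) ≤ pot (v ψ b * v ψ a) := by
  by_contra! hc
  obtain ⟨τ, hτ, h1, h2⟩ := exists_letter_left a b hab
  refine absurd (h τ hτ) (not_le.2 ?_)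
  have e : pot ((ψ * τ) (of a.1)) < pot (ψ (of a.1)) := by
    rw [← pot_v, ← pot_v, v, MulAut.mul_apply, h1, _root_.map_mul]
    exact hc
  apply Finset.sum_lt_sum
  · intro i _
    by_cases hi : i = a.1
    · rw [hi]; exact e.le
    · rw [MulAut.mul_apply, h2 i hi]
  · exact ⟨a.1, Finset.mem_univ _, e⟩

theorem norm_le_of_pot (x y : FreeGroup (Fin g)) (h : pot x ≤ pot y) : norm x ≤ norm y := by
  rw [pot, pot, Prod.Lex.toLex_le_toLex] at h
  rcases h with h | h
  · exact h.le
  · exact h.1.le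

theorem eq_of_fst (a b : Fin g × Bool) (h : b ≠ il a) (h' : a.1 = b.1) : a = b :=
  Prod.ext h' ((red_iff a b).2 h h')

theorem mini_N1 (ψ : MulAut (FreeGroup (Fin g))) (h : Mini ψ) : N1 ψ := by
  intro a b hab
  by_cases hf : a.1 = b.1
  · obtain rfl := eq_of_fst a b hab hf
    have := cp_self_inv _ (v_ne_one ψ a)
    constructor <;> omega
  · have e1 := norm_le_of_pot _ _ (mini_pot ψ h b a (Ne.symm hf))
    have e2 := norm_le_of_pot _ _ (mini_pot ψ h (il a) (il b) hf)
    have e3 := cp_formula' (v ψ a) (v ψ b)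
    rw [v_il, v_il, ← mul_inv_rev, norm_inv_eq, norm_inv_eq] at e2
    constructor <;> omega

theorem mini_N2 (ψ : MulAut (FreeGroup (Fin g))) (h : Mini ψ) : N2 ψ := by
  intro a b c hab hbc
  by_contra! hc
  have h1 := mini_N1 ψ h a b hab
  have h2 := mini_N1 ψ h b c hbc
  have hfa : a.1 ≠ b.1 := by
    intro hf
    obtain rfl := eq_of_fst a b hab hf
    have := cp_self_inv _ (v_ne_one ψ a)
    omega
  have hfc : c.1 ≠ b.1 := by
    intro hf
    obtain rfl := eq_of_fst b c hbc hf.symm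
    have := cp_self_inv _ (v_ne_one ψ b)
    omega
  obtain ⟨m, hm⟩ : ∃ m, m = cp (v ψ b)⁻¹ (v ψ c) := ⟨_, rfl⟩
  have hn : norm (v ψ b) = 2 * m := by omega
  have hn' : norm (v ψ b)⁻¹ = 2 * m := by rw [norm_inv_eq, hn]
  rcases lt_trichotomy (code ((v ψ b).toWord.take m)) (code ((v ψ b)⁻¹.toWord.take m)) with hl | hl | hl
  · exact absurd (mini_pot ψ h c b hfc) (not_le.2 (pot_lt _ _ m hn hm.symm (by omega) hl))
  · have e := code_inj _ _ (by
      rw [List.length_take, List.length_take]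
      change min m (norm _) = min m (norm _)
      rw [norm_inv_eq]) hl
    have e2 := half_word _ m hn
    rw [← e] at e2
    apply v_ne_one ψ b
    rw [← mk_toWord (x := v ψ b), e2, ← mul_mk, ← inv_mk, mul_inv_cancel]
  · have := mini_pot ψ h (il a) (il b) hfa
    rw [v_il, v_il] at this
    refine absurd this (not_le.2 (pot_lt _ _ m hn' ?_ ?_ ?_))
    · rw [inv_inv, cp_comm]; omega
    · rw [norm_inv_eq]; omega
    · rw [inv_inv]; exact hl

theorem exists_flip (S : Finset (Fin g)) : ∃ τ ∈ Subgroup.closure (gens g),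
    ∀ i, τ (of i) = if i ∈ S then (of i)⁻¹ else of i := by
  induction S using Finset.induction_on with
  | empty => exact ⟨1, one_mem _, by simp⟩
  | insert k S hk ih =>
    obtain ⟨τ, hτ, h⟩ := ih
    obtain ⟨ι, hι, h3, h4⟩ := exists_inv k
    refine ⟨τ * ι, mul_mem hτ hι, ?_⟩
    intro i
    rw [MulAut.mul_apply]
    by_cases hi : i = k
    · subst hi
      rw [h3, _root_.map_inv, h]; simp [hk]
    · rw [h4 i hi, h]; simp [hi]

theorem mem_of_mini (ψ : MulAut (FreeGroup (Fin g))) (h : Mini ψ) :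
    ψ ∈ Subgroup.closure (gens g) := by
  choose a ha using exists_letter ψ (mini_N1 ψ h) (mini_N2 ψ h)
  have hv : ∀ j, ψ (of (a j).1) = of j ∨ ψ (of (a j).1) = (of j)⁻¹ := by
    intro j
    have := ha j
    rcases hj : a j with ⟨k, e⟩
    rw [hj] at this
    cases e
    · right
      rw [v, mk_false, _root_.map_inv] at this
      rw [← this, inv_inv]
    · left; exact this
  have hinj : Function.Injective fun j => (a j).1 := by
    intro i j hij
    have h1 := hv i
    have h2 := hv j
    simp only at hij
    rw [hij] at h1
    have key : of i = of j ∨ of i = (of j)⁻¹ := by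
      rcases h1 with h1 | h1 <;> rcases h2 with h2 | h2 <;> rw [h1] at h2
      · exact Or.inl h2
      · exact Or.inr h2
      · right; rw [← h2, inv_inv]
      · left; exact inv_injective h2
    rcases key with key | key
    · exact of_injective key
    · have := congrArg toWord key
      rw [toWord_inv, toWord_of, toWord_of] at this
      simp [invRev] at this
  let σ : Equiv.Perm (Fin g) := Equiv.ofBijective _ (Finite.injective_iff_bijective.1 hinj)
  have hσ : ∀ i, ψ (of i) = of (σ.symm i) ∨ ψ (of i) = (of (σ.symm i))⁻¹ := by
    intro i
    have := hv (σ.symm i)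
    have e : (a (σ.symm i)).1 = i := σ.apply_symm_apply i
    rwa [e] at this
  classical
  obtain ⟨τ, hτ, ht⟩ := exists_flip (Finset.univ.filter fun i => ψ (of i) ≠ of (σ.symm i))
  have : ψ * τ ∈ Subgroup.closure (gens g) := by
    apply Subgroup.subset_closure
    left
    refine ⟨σ.symm, fun i => ?_⟩
    rw [MulAut.mul_apply, ht]
    by_cases hi : ψ (of i) = of (σ.symm i)
    · simp [hi]
    · have h2 := (hσ i).resolve_left hi
      rw [if_pos (by simpa using hi), _root_.map_inv, h2, inv_inv]
  exact (Subgroup.mul_mem_cancel_right _ hτ).1 this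

theorem exists_mini (φ : MulAut (FreeGroup (Fin g))) :
    ∃ τ ∈ Subgroup.closure (gens g), Mini (φ * τ) := by
  let S : Set (ℕ ×ₗ ℕ) := {n | ∃ τ ∈ Subgroup.closure (gens g), tot (φ * τ) = n}
  have hS : S.Nonempty := ⟨_, 1, one_mem _, rfl⟩
  obtain ⟨τ, hτ, ht⟩ := wellFounded_lt.min_mem S hS
  refine ⟨τ, hτ, fun ρ hρ => ?_⟩
  rw [ht, mul_assoc]
  exact not_lt.1 (wellFounded_lt.not_lt_min S ⟨τ * ρ, mul_mem hτ hρ, rfl⟩)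

theorem closure_gens (g : ℕ) : Subgroup.closure (gens g) = ⊤ := by
  rw [Subgroup.eq_top_iff']
  intro φ
  obtain ⟨τ, hτ, h⟩ := exists_mini φ
  exact (Subgroup.mul_mem_cancel_right _ hτ).1 (mem_of_mini _ h)

end Nielsen10

/-- `Aut(F_g)` is generated by the elementary Nielsen transformations: permutations of the
free generators, inversion of one generator, and replacement of one generator by its product
with another. -/
theorem stmt10 (g : ℕ) (hg : 1 ≤ g) :
    Subgroup.closure {α : MulAut (FreeGroup (Fin g)) |
      (∃ π : Equiv.Perm (Fin g), ∀ i, α (FreeGroup.of i) = FreeGroup.of (π i)) ∨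
      (∃ k, α (FreeGroup.of k) = (FreeGroup.of k)⁻¹ ∧
        ∀ i, i ≠ k → α (FreeGroup.of i) = FreeGroup.of i) ∨
      (∃ k ℓ, k ≠ ℓ ∧ α (FreeGroup.of k) = FreeGroup.of k * FreeGroup.of ℓ ∧
        ∀ i, i ≠ k → α (FreeGroup.of i) = FreeGroup.of i)} = ⊤ := by
  exact Nielsen10.closure_gens g
end

section
/- The homomorphism ψ_g : Aut(F_g) → GL(g,ℤ) induced by abelianization of the free group is surjective. Concretely: for each index j, let e_j : F_g → ℤ denote the group homomorphism to the additive integers sending the free generator x_j to 1 and every other free generator x_k (k ≠ j) to 0, so that e_j(w) is the total exponent of x_j in the word w. Then for every A ∈ GL(g,ℤ) there exists an automorphism α of F_g such that e_j(α(x_i)) = A_{ij} for all indices i, j. -/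
open Matrix in
theorem unimod_clear {g : ℕ} (P : Matrix (Fin g) (Fin g) ℤ → Prop)
    (hT : ∀ (i j : Fin g) (c : ℤ) A, i ≠ j → P (transvection i j c * A) → P A)
    (k : Fin g)
    (hQ : ∀ A : Matrix (Fin g) (Fin g) ℤ, IsUnit A →
      (∀ j, j ≤ k → ∀ i, A i j = if i = j then 1 else 0) → P A) (n : ℕ) :
    ∀ A : Matrix (Fin g) (Fin g) ℤ, IsUnit A →
      (∀ j, j < k → ∀ i, A i j = if i = j then 1 else 0) → A k k = 1 →
      (Finset.univ.filter (fun i => i ≠ k ∧ A i k ≠ 0)).card = n → P A := by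
  induction n with
  | zero =>
    intro A hA hc hk hn
    refine hQ A hA ?_
    intro j hj i
    rcases hj.lt_or_eq with h | h
    · exact hc j h i
    · subst h
      by_cases hij : i = j
      · subst hij; simp [hk]
      · rw [if_neg hij]
        rw [Finset.card_eq_zero, Finset.filter_eq_empty_iff] at hn
        by_contra h0
        exact hn (Finset.mem_univ i) ⟨hij, h0⟩
  | succ n ih =>
    intro A hA hc hk hn
    have hne : (Finset.univ.filter (fun i => i ≠ k ∧ A i k ≠ 0)).Nonempty := by
      rw [← Finset.card_pos]; omega
    obtain ⟨i, hi⟩ := hne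
    have hi' := hi
    simp only [Finset.mem_filter, Finset.mem_univ, true_and] at hi'
    refine hT i k (-A i k) A hi'.1 (ih _ ?_ ?_ ?_ ?_)
    · refine IsUnit.mul ?_ hA
      rw [Matrix.isUnit_iff_isUnit_det, det_transvection_of_ne _ _ hi'.1]; exact isUnit_one
    · intro j hj a
      by_cases ha : a = i
      · subst ha
        rw [transvection_mul_apply_same, hc j hj k, if_neg hj.ne', hc j hj a]; simp
      · rw [transvection_mul_apply_of_ne _ _ _ _ ha, hc j hj a]
    · rw [transvection_mul_apply_of_ne _ _ _ _ hi'.1.symm, hk]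
    · have : (Finset.univ.filter (fun a => a ≠ k ∧ (transvection i k (-A i k) * A) a k ≠ 0))
          = (Finset.univ.filter (fun i => i ≠ k ∧ A i k ≠ 0)).erase i := by
        ext a
        by_cases ha : a = i
        · subst ha
          simp [transvection_mul_apply_same, hk]
        · simp [transvection_mul_apply_of_ne _ _ _ _ ha, ha]
      rw [this, Finset.card_erase_of_mem hi, hn]; rfl

open Matrix in
theorem unimod_step {g : ℕ} (P : Matrix (Fin g) (Fin g) ℤ → Prop)
    (hT : ∀ (i j : Fin g) (c : ℤ) A, i ≠ j → P (transvection i j c * A) → P A)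
    (hD : ∀ (i : Fin g) A, P (diagonal (fun a => if a = i then (-1 : ℤ) else 1) * A) → P A)
    (k : Fin g)
    (hQ : ∀ A : Matrix (Fin g) (Fin g) ℤ, IsUnit A →
      (∀ j, j ≤ k → ∀ i, A i j = if i = j then 1 else 0) → P A) (n : ℕ) :
    ∀ A : Matrix (Fin g) (Fin g) ℤ, IsUnit A →
      (∀ j, j < k → ∀ i, A i j = if i = j then 1 else 0) →
      (∑ i ∈ Finset.univ.filter (fun i => k ≤ i), (A i k).natAbs) = n → P A := by
  induction n using Nat.strong_induction_on with
  | _ n ih =>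
  intro A hA hc hn
  have hU : ∀ i j : Fin g, ∀ c : ℤ, i ≠ j → IsUnit (transvection i j c * A) := by
    intro i j c hij
    refine IsUnit.mul ?_ hA
    rw [Matrix.isUnit_iff_isUnit_det, det_transvection_of_ne _ _ hij]; exact isUnit_one
  have hC : ∀ i j' : Fin g, ∀ c : ℤ, k ≤ j' →
      (∀ j, j < k → ∀ a, (transvection i j' c * A) a j = if a = j then 1 else 0) := by
    intro i j' c hj' j hj a
    by_cases ha : a = i
    · subst ha
      rw [transvection_mul_apply_same, hc j hj j', if_neg (hj.trans_le hj').ne', hc j hj a]; simp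
    · rw [transvection_mul_apply_of_ne _ _ _ _ ha, hc j hj a]
  by_cases h2 : ∃ i j : Fin g, k ≤ i ∧ k ≤ j ∧ i ≠ j ∧ A j k ≠ 0 ∧
      (A j k).natAbs ≤ (A i k).natAbs
  · obtain ⟨i, j, hi, hj, hij, h0, hle⟩ := h2
    refine hT i j (-(A i k / A j k)) A hij (ih _ ?_ _ (hU _ _ _ hij) (hC _ _ _ hj) rfl)
    rw [← hn]
    apply Finset.sum_lt_sum
    · intro a _
      by_cases ha : a = i
      · subst ha
        rw [transvection_mul_apply_same]
        have h1 := Int.emod_nonneg (A a k) h0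
        have h2 := Int.emod_lt_abs (A a k) h0
        have h3 := Int.emod_def (A a k) (A j k)
        have : A a k + -(A a k / A j k) * A j k = A a k % A j k := by rw [h3]; ring
        rw [this]; rw [Int.abs_eq_natAbs] at h2; clear h3 this; omega
      · rw [transvection_mul_apply_of_ne _ _ _ _ ha]
    · refine ⟨i, by simp [hi], ?_⟩
      rw [transvection_mul_apply_same]
      have h1 := Int.emod_nonneg (A i k) h0
      have h2 := Int.emod_lt_abs (A i k) h0
      have h3 := Int.emod_def (A i k) (A j k)
      have : A i k + -(A i k / A j k) * A j k = A i k % A j k := by rw [h3]; ring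
      rw [this]; rw [Int.abs_eq_natAbs] at h2; clear h3 this; omega
  · push Not at h2
    -- at most one nonzero entry
    have huniq : ∀ i j : Fin g, k ≤ i → k ≤ j → i ≠ j → A j k ≠ 0 → A i k = 0 := by
      intro i j hi hj hij h0
      by_contra h1
      have a1 := h2 i j hi hj hij h0
      have a2 := h2 j i hj hi hij.symm h1
      omega
    obtain ⟨C, hCA⟩ : ∃ C, C * A = 1 := hA.exists_left_inv
    have key : ∃ i, k ≤ i ∧ IsUnit (A i k) := by
      let v : Fin g → ℤ := fun j => if j < k then -A j k else if j = k then 1 else 0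
      have hAv : ∀ a, (A *ᵥ v) a = if k ≤ a then A a k else 0 := by
        intro a
        have : ∀ j, A a j * v j =
            (if j = a then (if a < k then -A a k else 0) else 0) + (if j = k then A a k else 0) := by
          intro j
          simp only [v]
          by_cases hj : j < k
          · rw [hc j hj a, if_pos hj, if_neg hj.ne]
            by_cases haj : a = j
            · subst haj; simp [hj]
            · simp [haj, Ne.symm haj]
          · by_cases hjk : j = k
            · subst hjk
              by_cases hja : j = a
              · subst hja; simp
              · simp [hja]
            · by_cases hja : j = a
              · subst hja; simp [hj, hjk]
              · simp [hj, hjk, hja]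
        simp only [mulVec, dotProduct]
        rw [Finset.sum_congr rfl (fun j _ => this j), Finset.sum_add_distrib]
        by_cases hak : a < k
        · simp [hak, not_le.mpr hak]
        · simp [hak, not_lt.mp hak]
      have hv : C *ᵥ (A *ᵥ v) = v := by rw [mulVec_mulVec, hCA, one_mulVec]
      have hk1 : ∑ a, C k a * (if k ≤ a then A a k else 0) = 1 := by
        have := congrFun hv k
        simp only [mulVec, dotProduct] at this hAv
        simp only [hAv] at this
        rw [this]; simp [v]
      by_cases hz : ∃ i, k ≤ i ∧ A i k ≠ 0
      · obtain ⟨i, hi, h0⟩ := hz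
        refine ⟨i, hi, ?_⟩
        rw [Finset.sum_eq_single i] at hk1
        · rw [if_pos hi] at hk1
          exact IsUnit.of_mul_eq_one_right _ hk1
        · intro b _ hb
          split_ifs with hkb
          · rw [huniq b i hkb hi hb h0, mul_zero]
          · simp
        · simp
      · push Not at hz
        rw [Finset.sum_eq_zero] at hk1
        · simp at hk1
        · intro a _
          split_ifs with h
          · rw [hz a h, mul_zero]
          · simp
    obtain ⟨i, hi, hu⟩ := key
    by_cases hik : i = k
    · subst hik
      rcases Int.isUnit_iff.mp hu with h1 | h1
      · exact unimod_clear P hT i hQ _ A hA hc h1 rfl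
      · refine hD i A (unimod_clear P hT i hQ _ _ ?_ ?_ ?_ rfl)
        · refine IsUnit.mul ?_ hA
          rw [Matrix.isUnit_iff_isUnit_det, det_diagonal, Finset.prod_ite_eq']
          simp
        · intro j hj a
          rw [diagonal_mul, hc j hj a]
          by_cases ha : a = i
          · subst ha; simp [hj.ne']
          · simp [ha]
        · rw [diagonal_mul, h1]; simp
    · refine hT k i (A i k) A (Ne.symm hik)
        (unimod_clear P hT k hQ _ _ (hU _ _ _ (Ne.symm hik)) (hC _ _ _ hi) ?_ rfl)
      rw [transvection_mul_apply_same, huniq k i le_rfl hi (Ne.symm hik) hu.ne_zero]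
      rcases Int.isUnit_iff.mp hu with h1 | h1 <;> simp [h1]

open Matrix in
theorem unimod_ind {g : ℕ} (P : Matrix (Fin g) (Fin g) ℤ → Prop) (h1 : P 1)
    (hT : ∀ (i j : Fin g) (c : ℤ) A, i ≠ j → P (transvection i j c * A) → P A)
    (hD : ∀ (i : Fin g) A, P (diagonal (fun a => if a = i then (-1 : ℤ) else 1) * A) → P A)
    (A : Matrix (Fin g) (Fin g) ℤ) (hA : IsUnit A) : P A := by
  have main : ∀ m : ℕ, m ≤ g → ∀ A : Matrix (Fin g) (Fin g) ℤ, IsUnit A →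
      (∀ j : Fin g, (j : ℕ) < g - m → ∀ i, A i j = if i = j then 1 else 0) → P A := by
    intro m
    induction m with
    | zero =>
      intro _ A _ hc
      have : A = 1 := by
        ext i j
        rw [hc j (by simp) i, Matrix.one_apply]
      rw [this]; exact h1
    | succ m ih =>
      intro hm A hA hc
      let k : Fin g := ⟨g - (m + 1), by omega⟩
      refine unimod_step P hT hD k ?_ _ A hA ?_ rfl
      · intro B hB hcB
        refine ih (by omega) B hB (fun j hj i => hcB j ?_ i)
        rw [Fin.le_def]; simp only [k]; omega
      · intro j hj i
        exact hc j (by rw [Fin.lt_def] at hj; exact hj) i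
  exact main g le_rfl A hA (by intro j hj; omega)

theorem stmt11_comp {g : ℕ}
    (e : Fin g → (FreeGroup (Fin g) →* Multiplicative ℤ))
    (he : ∀ j k : Fin g,
      e j (FreeGroup.of k) = Multiplicative.ofAdd (if k = j then (1 : ℤ) else 0))
    (A : Matrix (Fin g) (Fin g) ℤ) (α : MulAut (FreeGroup (Fin g)))
    (hα : ∀ i j : Fin g, Multiplicative.toAdd (e j (α (FreeGroup.of i))) = A i j)
    (j : Fin g) (w : FreeGroup (Fin g)) :
    Multiplicative.toAdd (e j (α w)) = ∑ k, Multiplicative.toAdd (e k w) * A k j := by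
  induction w using FreeGroup.induction_on with
  | C1 => simp
  | of i => simp [hα, he]
  | inv_of i h => simp [hα, he]
  | mul x y hx hy => simp [hx, hy, add_mul, Finset.sum_add_distrib]

/-- The automorphism `x_i ↦ x_j ^ c * x_i`. -/
def transvAut {g : ℕ} (i j : Fin g) (c : ℤ) (hij : i ≠ j) : MulAut (FreeGroup (Fin g)) :=
  MonoidHom.toMulEquiv
    (FreeGroup.lift fun a => if a = i then FreeGroup.of j ^ c * FreeGroup.of i else FreeGroup.of a)
    (FreeGroup.lift fun a =>
      if a = i then FreeGroup.of j ^ (-c) * FreeGroup.of i else FreeGroup.of a)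
    (by
      ext a
      by_cases ha : a = i
      · subst ha; simp [hij.symm]
      · simp [ha])
    (by
      ext a
      by_cases ha : a = i
      · subst ha; simp [hij.symm]
      · simp [ha])

/-- The automorphism `x_i ↦ x_i⁻¹`. -/
def flipAut {g : ℕ} (i : Fin g) : MulAut (FreeGroup (Fin g)) :=
  MonoidHom.toMulEquiv
    (FreeGroup.lift fun a => if a = i then (FreeGroup.of i)⁻¹ else FreeGroup.of a)
    (FreeGroup.lift fun a => if a = i then (FreeGroup.of i)⁻¹ else FreeGroup.of a)
    (by
      ext a
      by_cases ha : a = i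
      · subst ha; simp
      · simp [ha])
    (by
      ext a
      by_cases ha : a = i
      · subst ha; simp
      · simp [ha])

/-- The homomorphism `ψ_g : Aut(F_g) → GL(g,ℤ)` induced by abelianization is surjective:
for every unimodular integer matrix `A` there is an automorphism `α` of the free group `F_g`
whose matrix of total exponents is `A`. Here `e j : F_g →* Multiplicative ℤ` is the
homomorphism sending the generator `x_j` to `1` and all other generators to `0`, so
`(e j) w` is the total exponent of `x_j` in `w`. -/
theorem stmt11 (g : ℕ)
    (e : Fin g → (FreeGroup (Fin g) →* Multiplicative ℤ))
    (he : ∀ j k : Fin g,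
      e j (FreeGroup.of k) = Multiplicative.ofAdd (if k = j then (1 : ℤ) else 0))
    (A : Matrix (Fin g) (Fin g) ℤ) (hA : IsUnit A) :
    ∃ α : MulAut (FreeGroup (Fin g)), ∀ i j : Fin g,
      Multiplicative.toAdd (e j (α (FreeGroup.of i))) = A i j := by
  have hmul : ∀ (B A : Matrix (Fin g) (Fin g) ℤ) (α β : MulAut (FreeGroup (Fin g))),
      (∀ i j : Fin g, Multiplicative.toAdd (e j (α (FreeGroup.of i))) = A i j) →
      (∀ i j : Fin g, Multiplicative.toAdd (e j (β (FreeGroup.of i))) = B i j) →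
      ∀ i j : Fin g, Multiplicative.toAdd (e j ((α * β) (FreeGroup.of i))) = (B * A) i j := by
    intro B A α β hα hβ i j
    rw [MulAut.mul_apply, stmt11_comp e he A α hα, Matrix.mul_apply]
    simp [hβ]
  refine unimod_ind (fun A => ∃ α : MulAut (FreeGroup (Fin g)), ∀ i j : Fin g,
      Multiplicative.toAdd (e j (α (FreeGroup.of i))) = A i j) ?_ ?_ ?_ A hA
  · exact ⟨1, fun i j => by simp [he, Matrix.one_apply]⟩
  · rintro i j c A hij ⟨α, hα⟩
    refine ⟨α * transvAut i j (-c) hij, ?_⟩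
    have hA' : A = Matrix.transvection i j (-c) * (Matrix.transvection i j c * A) := by
      rw [← Matrix.mul_assoc, Matrix.transvection_mul_transvection_same _ _ hij]; simp
    rw [hA']
    refine hmul _ _ _ _ hα ?_
    intro a b
    by_cases ha : a = i
    · subst ha
      by_cases hb : j = b <;>
      simp [transvAut, he, Matrix.transvection, Matrix.one_apply, Matrix.single_apply, hb, add_comm]
    · simp [transvAut, he, Matrix.transvection, Matrix.one_apply, Matrix.single_apply, ha,
        Ne.symm ha]
  · rintro i A ⟨α, hα⟩
    refine ⟨α * flipAut i, ?_⟩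
    have hA' : A = Matrix.diagonal (fun a => if a = i then (-1 : ℤ) else 1) *
        (Matrix.diagonal (fun a => if a = i then (-1 : ℤ) else 1) * A) := by
      ext a b
      rw [Matrix.diagonal_mul, Matrix.diagonal_mul]
      split_ifs <;> simp
    rw [hA']
    refine hmul _ _ _ _ hα ?_
    intro a b
    by_cases ha : a = i
    · subst ha
      by_cases hb : a = b <;> simp [flipAut, he, Matrix.diagonal_apply, hb]
    · simp [flipAut, he, Matrix.diagonal_apply, ha]
end

section
/- Let g > 2 and let G be a group such that every automorphism of G is inner. Let ψ : G → GL(g,ℤ) be a surjective group homomorphism, and assume that the inverse-transpose map A ↦ (Aᵀ)⁻¹ is not an inner automorphism of GL(g,ℤ). Then no element of IT(ψ) is an automorphism of G. (In the paper's case G = Aut(F_g) with ψ = ψ_g: all automorphisms of Aut(F_g) are inner for g > 2 by Bridson–Vogtmann, and inverse-transpose is not inner on GL(g,ℤ) for g > 2 by Hua–Reiner; hence no element of IT_g is an automorphism of Aut(F_g).) -/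
open Matrix

/-- Let `g > 2`, let `G` be a group all of whose automorphisms are inner, and let
`ψ : G → GL(g,ℤ)` be a surjective homomorphism. If the inverse-transpose map is not an inner
automorphism of `GL(g,ℤ)`, then no element of `IT(ψ)` is an automorphism of `G`.
(In the paper, `G = Aut(F_g)` and `ψ = ψ_g`.) -/
theorem stmt14 (g : ℕ) (hg : 2 < g) (G : Type*) [Group G]
    (hinner : ∀ χ : MulAut G, ∃ h : G, ∀ x : G, χ x = h * x * h⁻¹)
    (ψ : G →* (Matrix (Fin g) (Fin g) ℤ)ˣ)
    (hsurj : Function.Surjective ψ)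
    (hnotinner : ¬ ∃ U : (Matrix (Fin g) (Fin g) ℤ)ˣ,
      ∀ A : (Matrix (Fin g) (Fin g) ℤ)ˣ,
        (((A : Matrix (Fin g) (Fin g) ℤ)ᵀ)⁻¹ : Matrix (Fin g) (Fin g) ℤ) =
          ((U * A * U⁻¹ : (Matrix (Fin g) (Fin g) ℤ)ˣ) : Matrix (Fin g) (Fin g) ℤ))
    (it : G → G)
    (hit : ∀ α : G,
      ((ψ (it α) : (Matrix (Fin g) (Fin g) ℤ)ˣ) : Matrix (Fin g) (Fin g) ℤ) =
        (((ψ α : (Matrix (Fin g) (Fin g) ℤ)ˣ) : Matrix (Fin g) (Fin g) ℤ)ᵀ)⁻¹) :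
    ¬ ∃ χ : MulAut G, ∀ x : G, χ x = it x := by
  rintro ⟨χ, hχ⟩
  obtain ⟨h, hh⟩ := hinner χ
  refine hnotinner ⟨ψ h, fun A => ?_⟩
  obtain ⟨α, rfl⟩ := hsurj A
  rw [← hit α, ← hχ α, hh α, map_mul, map_mul, map_inv]
end

section
/- Let g ≥ 4 and let X ∈ Sp(2g,ℤ) with block decomposition X = [[A,B],[C,D]] into integer g×g blocks. For k ∈ {1,…,g}, let M_k be the diagonal g×g matrix with diagonal entries 1 except for −1 at position k, and for a permutation π of {1,…,g} let ι(π) be the permutation matrix (ι(π))_{ij} = δ_{i,π(j)}. Suppose X commutes with D_{M_k} for every k > 2, and X commutes with D_{ι(π)} for every permutation π with π(1) = 1 and π(2) = 2. Then each of the blocks A, B, C, D is zero outside the union of its top-left 2×2 block and its diagonal, and its diagonal entries at positions 3,…,g are all equal; moreover, writing Â, B̂, Ĉ, D̂ for the top-left 2×2 blocks and a, b, c, d for the common diagonal values of A, B, C, D respectively, the 4×4 matrix [[Â,B̂],[Ĉ,D̂]] lies in Sp(4,ℤ) and the 2×2 matrix [[a,b],[c,d]] lies in SL(2,ℤ). 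-/
open Matrix

/-- `M_k`: the diagonal matrix with all diagonal entries `1` except `−1` at position `k`. -/
def Mneg {g : ℕ} (k : Fin g) : Matrix (Fin g) (Fin g) ℤ :=
  Matrix.diagonal (fun i => if i = k then -1 else 1)

/-- The permutation matrix `ι(π)` with entries `(ι(π))_{ij} = δ_{i, π(j)}`. -/
def permMat {g : ℕ} (π : Equiv.Perm (Fin g)) : Matrix (Fin g) (Fin g) ℤ :=
  Matrix.of fun i j => if i = π j then 1 else 0

/-- `P` vanishes outside the union of its top-left `2×2` block and its diagonal, and all its
diagonal entries beyond the first two are equal to `p`. -/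
def BlockShape {g : ℕ} (P : Matrix (Fin g) (Fin g) ℤ) (p : ℤ) : Prop :=
  (∀ i j : Fin g, ¬((i : ℕ) < 2 ∧ (j : ℕ) < 2) → i ≠ j → P i j = 0) ∧
  (∀ i : Fin g, 2 ≤ (i : ℕ) → P i i = p)

/-- The top-left `2×2` submatrix of a `g×g` matrix (for `2 ≤ g`). -/
def sub2 {g : ℕ} (h : 2 ≤ g) (P : Matrix (Fin g) (Fin g) ℤ) : Matrix (Fin 2) (Fin 2) ℤ :=
  P.submatrix (Fin.castLE h) (Fin.castLE h)

theorem aux_mneg_inv {g : ℕ} (k : Fin g) : ((Mneg k)ᵀ)⁻¹ = Mneg k := by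
  apply Matrix.inv_eq_right_inv
  unfold Mneg
  rw [Matrix.diagonal_transpose, Matrix.diagonal_mul_diagonal, ← Matrix.diagonal_one]
  congr 1
  funext i
  split_ifs <;> simp

theorem aux_perm_inv {g : ℕ} (p : Equiv.Perm (Fin g)) : ((permMat p)ᵀ)⁻¹ = permMat p := by
  apply Matrix.inv_eq_right_inv
  ext i j
  simp [permMat, Matrix.mul_apply, Matrix.one_apply, eq_comm]

theorem aux_comm {g : ℕ} {A B C D M : Matrix (Fin g) (Fin g) ℤ} (hM : (Mᵀ)⁻¹ = M)
    (h : Matrix.fromBlocks A B C D * Dmat M = Dmat M * Matrix.fromBlocks A B C D) :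
    A * M = M * A ∧ B * M = M * B ∧ C * M = M * C ∧ D * M = M * D := by
  unfold Dmat at h
  rw [hM, Matrix.fromBlocks_multiply, Matrix.fromBlocks_multiply, Matrix.fromBlocks_inj] at h
  simpa using h

theorem aux_shape {g : ℕ} (hg : 4 ≤ g) (P : Matrix (Fin g) (Fin g) ℤ)
    (h1 : ∀ k : Fin g, 2 ≤ (k : ℕ) → P * Mneg k = Mneg k * P)
    (h2 : ∀ p : Equiv.Perm (Fin g), (∀ i : Fin g, (i : ℕ) < 2 → p i = i) →
      P * permMat p = permMat p * P) : BlockShape P (P ⟨2, by omega⟩ ⟨2, by omega⟩) := by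
  constructor
  · intro i j hij hne
    have key : ∀ k : Fin g, 2 ≤ (k : ℕ) → (k = i ∨ k = j) → P i j = 0 := by
      intro k hk hkk
      have h := congrFun (congrFun (h1 k hk) i) j
      simp only [Mneg, Matrix.mul_diagonal, Matrix.diagonal_mul] at h
      rcases hkk with rfl | rfl
      · rw [if_neg hne.symm, if_pos rfl] at h; omega
      · rw [if_pos rfl, if_neg hne] at h; omega
    by_cases hi : (i : ℕ) < 2
    · exact key j (by omega) (Or.inr rfl)
    · exact key i (by omega) (Or.inl rfl)
  · intro i hi
    set t : Fin g := ⟨2, by omega⟩ with ht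
    have h := congrFun (congrFun (h2 (Equiv.swap i t) (by
      intro l hl
      apply Equiv.swap_apply_of_ne_of_ne
      · rintro rfl; omega
      · rintro rfl; simp [ht] at hl)) i) t
    have e : ∀ x : Fin g, (i = Equiv.swap i t x) ↔ x = t := by
      intro x
      rw [eq_comm, Equiv.swap_apply_eq_iff, Equiv.swap_apply_left]
    simpa [permMat, Matrix.mul_apply, e] using h

theorem aux_sub2 {g : ℕ} (h : 2 ≤ g) {P Q : Matrix (Fin g) (Fin g) ℤ} {p q : ℤ}
    (hP : BlockShape P p) (_hQ : BlockShape Q q) :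
    (sub2 h P)ᵀ * sub2 h Q = sub2 h (Pᵀ * Q) := by
  obtain ⟨n, rfl⟩ := Nat.exists_eq_add_of_le h
  ext i j
  simp only [sub2, Matrix.mul_apply, Matrix.transpose_apply, Matrix.submatrix_apply]
  rw [Fin.sum_univ_add (a := 2) (b := n)]
  rw [Finset.sum_eq_zero (s := (Finset.univ : Finset (Fin n))), add_zero]
  · rfl
  · intro k _
    rw [hP.1, zero_mul]
    · simp
      omega
    · intro hh
      have := congrArg Fin.val hh
      simp at this
      omega

theorem aux_diag {g : ℕ} {P Q : Matrix (Fin g) (Fin g) ℤ} {p q : ℤ}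
    (hP : BlockShape P p) (hQ : BlockShape Q q) (i : Fin g) (hi : 2 ≤ (i : ℕ)) :
    (Pᵀ * Q) i i = p * q := by
  rw [Matrix.mul_apply, Finset.sum_eq_single i]
  · rw [Matrix.transpose_apply, hP.2 i hi, hQ.2 i hi]
  · intro k _ hk
    rw [Matrix.transpose_apply, hP.1 k i (by omega) hk, zero_mul]
  · simp

theorem aux_symp {g : ℕ} (A B C D : Matrix (Fin g) (Fin g) ℤ) :
    IsSymplectic (Matrix.fromBlocks A B C D) ↔
      (-(Cᵀ * A) + Aᵀ * C = 0 ∧ -(Cᵀ * B) + Aᵀ * D = 1 ∧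
        -(Dᵀ * A) + Bᵀ * C = -1 ∧ -(Dᵀ * B) + Bᵀ * D = 0) := by
  unfold IsSymplectic Jmat
  rw [Matrix.fromBlocks_transpose, Matrix.fromBlocks_multiply, Matrix.fromBlocks_multiply,
    Matrix.fromBlocks_inj]
  simp

/-- Structure of a symplectic matrix commuting with `D_{M_k}` for `k > 2` and with
`D_{ι(π)}` for all permutations `π` fixing the first two indices: every block is supported on
its top-left `2×2` block and diagonal, the extra diagonal entries of each block are constant,
the assembled `4×4` matrix of top-left blocks lies in `Sp(4,ℤ)`, and the `2×2` matrix of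
common diagonal values lies in `SL(2,ℤ)`. -/
theorem stmt17 (g : ℕ) (hg : 4 ≤ g)
    (A B C D : Matrix (Fin g) (Fin g) ℤ)
    (hX : IsSymplectic (Matrix.fromBlocks A B C D))
    (hcomm1 : ∀ k : Fin g, 2 ≤ (k : ℕ) →
      Matrix.fromBlocks A B C D * Dmat (Mneg k) = Dmat (Mneg k) * Matrix.fromBlocks A B C D)
    (hcomm2 : ∀ π : Equiv.Perm (Fin g), (∀ i : Fin g, (i : ℕ) < 2 → π i = i) →
      Matrix.fromBlocks A B C D * Dmat (permMat π) =
        Dmat (permMat π) * Matrix.fromBlocks A B C D) :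
    ∃ a b c d : ℤ,
      BlockShape A a ∧ BlockShape B b ∧ BlockShape C c ∧ BlockShape D d ∧
      IsSymplectic (Matrix.fromBlocks
        (sub2 (by omega) A) (sub2 (by omega) B) (sub2 (by omega) C) (sub2 (by omega) D)) ∧
      Matrix.det !![a, b; c, d] = 1 := by
  have c1 := fun k hk => aux_comm (aux_mneg_inv k) (hcomm1 k hk)
  have c2 := fun p hp => aux_comm (aux_perm_inv p) (hcomm2 p hp)
  have sA := aux_shape hg A (fun k hk => (c1 k hk).1) (fun p hp => (c2 p hp).1)
  have sB := aux_shape hg B (fun k hk => (c1 k hk).2.1) (fun p hp => (c2 p hp).2.1)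
  have sC := aux_shape hg C (fun k hk => (c1 k hk).2.2.1) (fun p hp => (c2 p hp).2.2.1)
  have sD := aux_shape hg D (fun k hk => (c1 k hk).2.2.2) (fun p hp => (c2 p hp).2.2.2)
  refine ⟨_, _, _, _, sA, sB, sC, sD, ?_, ?_⟩
  · rw [aux_symp] at hX ⊢
    obtain ⟨x1, x2, x3, x4⟩ := hX
    have h : 2 ≤ g := by omega
    have one : sub2 h (1 : Matrix (Fin g) (Fin g) ℤ) = 1 :=
      Matrix.submatrix_one _ (Fin.castLE_injective h)
    rw [aux_sub2 h sC sA, aux_sub2 h sA sC, aux_sub2 h sC sB, aux_sub2 h sA sD,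
      aux_sub2 h sD sA, aux_sub2 h sB sC, aux_sub2 h sD sB, aux_sub2 h sB sD, ← one]
    refine ⟨?_, ?_, ?_, ?_⟩
    · exact congrArg (sub2 h) x1
    · exact congrArg (sub2 h) x2
    · exact congrArg (sub2 h) x3
    · exact congrArg (sub2 h) x4
  · rw [aux_symp] at hX
    have x := congrFun (congrFun hX.2.1 ⟨2, by omega⟩) ⟨2, by omega⟩
    rw [Matrix.add_apply, Matrix.neg_apply, aux_diag sC sB _ le_rfl, aux_diag sA sD _ le_rfl,
      Matrix.one_apply_eq] at x
    rw [Matrix.det_fin_two_of]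
    linarith
end
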